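/- Second-order asymptotics for the rate-distortion problem: under the stated assumptions, for every ε ∈ (0,1), log M*(n,D,ε) = n R(P_X,D) + √(n V(P_X,D)) Q^{-1}(ε) + O(log n) as n → ∞. -/

import Mathlib

/-!
Second-order asymptotics for the rate-distortion problem
(Ingber–Kochman / Kostina–Verdú, Theorem `second4rd`).
-/

open scoped BigOperators

noncomputable section

/-- i.i.d. product pmf on length-`n` strings. -/
def iidP {α : Type*} [Fintype α] (p : α → ℝ) (n : ℕ) : (Fin n → α) → ℝ :=
  fun xs => ∏ i, p (xs i)

/-- Probability of an event under a pmf on a finite space. -/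
def Pr {Ω : Type*} [Fintype Ω] (μ : Ω → ℝ) (A : Set Ω) : ℝ :=
  ∑ ω, A.indicator μ ω

/-- Average per-letter distortion of a block. -/
def distn {α β : Type*} {n : ℕ} (d : α → β → ℝ) (xs : Fin n → α) (ys : Fin n → β) : ℝ :=
  (∑ i, d (xs i) (ys i)) / n

/-- A conditional pmf (test channel). -/
def IsChannel {α β : Type*} [Fintype β] (W : α → β → ℝ) : Prop :=
  ∀ a, (∀ b, 0 ≤ W a b) ∧ ∑ b, W a b = 1

/-- Mutual information `I(p, W)`. -/
def mutInfo {α β : Type*} [Fintype α] [Fintype β] (p : α → ℝ) (W : α → β → ℝ) : ℝ :=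
  ∑ a, ∑ b, p a * W a b * Real.log (W a b / (∑ a', p a' * W a' b))

/-- The rate-distortion function `R(p, D)`. -/
def RDfun {α β : Type*} [Fintype α] [Fintype β] (p : α → ℝ) (d : α → β → ℝ) (D : ℝ) : ℝ :=
  sInf {r | ∃ W : α → β → ℝ, IsChannel W ∧
    (∑ a, ∑ b, p a * W a b * d a b) ≤ D ∧ r = mutInfo p W}

/-- Output marginal induced by a source pmf and a channel. -/
def outMarg {α β : Type*} [Fintype α] (p : α → ℝ) (W : α → β → ℝ) : β → ℝ :=
  fun b => ∑ a, p a * W a b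

/-- The `D`-tilted information density. -/
def dtilted {α β : Type*} [Fintype β] (d : α → β → ℝ) (D : ℝ) (Q : β → ℝ) (lam : ℝ) :
    α → ℝ :=
  fun x => -Real.log (∑ y, Q y * Real.exp (lam * D - lam * d x y))

/-- Mean of a real function under a pmf. -/
def meanF {α : Type*} [Fintype α] (p : α → ℝ) (g : α → ℝ) : ℝ := ∑ a, p a * g a

/-- Variance of a real function under a pmf. -/
def varF {α : Type*} [Fintype α] (p : α → ℝ) (g : α → ℝ) : ℝ :=
  ∑ a, p a * (g a - meanF p g) ^ 2

/-- Minimum codebook size of an `(n,M)`-code with excess-distortion probability ≤ `ε`. -/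
def MstarRD {𝒳 Xh : Type} [Fintype 𝒳] [Fintype Xh]
    (P : 𝒳 → ℝ) (d : 𝒳 → Xh → ℝ) (n : ℕ) (D ε : ℝ) : ℕ :=
  sInf {M : ℕ | 0 < M ∧ ∃ (f : (Fin n → 𝒳) → Fin M) (φ : Fin M → (Fin n → Xh)),
    Pr (iidP P n) {xs | D < distn d xs (φ (f xs))} ≤ ε}

/-- The Gaussian complementary cdf. -/
def gaussQ (t : ℝ) : ℝ :=
  ∫ u in Set.Ioi t, Real.exp (-u ^ 2 / 2) / Real.sqrt (2 * Real.pi)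

/-- product weight -/
def prodW {α : Type*} {n : ℕ} (w : Fin n → α → ℝ) : (Fin n → α) → ℝ :=
  fun ys => ∏ i, w i (ys i)

lemma iidP_eq_prodW {α : Type*} [Fintype α] (p : α → ℝ) (n : ℕ) :
    iidP p n = prodW (fun _ => p) := rfl

lemma prod_sum_gen {R α : Type*} [CommRing R] [Fintype α] {n : ℕ} (f : Fin n → α → R) :
    ∑ ys : Fin n → α, ∏ i, f i (ys i) = ∏ i, ∑ a, f i a := by
  classical
  rw [Finset.prod_univ_sum]
  simp

lemma prodW_mul_prod {α : Type*} [Fintype α] {n : ℕ} (w f : Fin n → α → ℝ) :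
    ∑ ys, prodW w ys * ∏ i, f i (ys i) = ∏ i, ∑ a, w i a * f i a := by
  simp only [prodW, ← Finset.prod_mul_distrib]
  exact prod_sum_gen (fun i a => w i a * f i a)

lemma prodW_nonneg {α : Type*} {n : ℕ} {w : Fin n → α → ℝ} (h : ∀ i a, 0 ≤ w i a) (ys) :
    0 ≤ prodW w ys := Finset.prod_nonneg fun i _ => h i _

lemma prodW_sum_one {α : Type*} [Fintype α] {n : ℕ} {w : Fin n → α → ℝ}
    (h : ∀ i, ∑ a, w i a = 1) : ∑ ys, prodW w ys = 1 := by
  have := prodW_mul_prod w (fun _ _ => 1)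
  simpa [h] using this

lemma prodW_marg {α : Type*} [Fintype α] {n : ℕ} {w : Fin n → α → ℝ}
    (h : ∀ i, ∑ a, w i a = 1) (i : Fin n) (f : α → ℝ) :
    ∑ ys, prodW w ys * f (ys i) = ∑ a, w i a * f a := by
  classical
  have := prodW_mul_prod w (fun k a => if k = i then f a else 1)
  have e : ∀ k, ∑ a, w k a * (if k = i then f a else 1)
      = if k = i then ∑ a, w i a * f a else 1 := by
    intro k
    split_ifs with hk
    · subst hk; rfl
    · simp [h]
  rw [Finset.prod_congr rfl fun k _ => e k] at this
  simpa only [Finset.prod_ite_eq', Finset.mem_univ, if_true] using this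

lemma prodW_marg2 {α : Type*} [Fintype α] {n : ℕ} {w : Fin n → α → ℝ}
    (h : ∀ i, ∑ a, w i a = 1) (i j : Fin n) (hij : i ≠ j) (f g : α → ℝ) :
    ∑ ys, prodW w ys * (f (ys i) * g (ys j)) = (∑ a, w i a * f a) * ∑ a, w j a * g a := by
  classical
  have := prodW_mul_prod w (fun k a => (if k = i then f a else 1) * (if k = j then g a else 1))
  have e : ∀ k, ∑ a, w k a * ((if k = i then f a else 1) * (if k = j then g a else 1))
      = (if k = i then ∑ a, w i a * f a else 1) * (if k = j then ∑ a, w j a * g a else 1) := by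
    intro k
    split_ifs with hk hj hj
    · exact absurd (hk.symm.trans hj) hij
    · subst hk; simp
    · subst hj; simp
    · simp [h]
  rw [Finset.prod_congr rfl fun k _ => e k] at this
  simpa only [Finset.prod_mul_distrib, Finset.prod_ite_eq', Finset.mem_univ, if_true] using this

lemma prodW_mean {α : Type*} [Fintype α] {n : ℕ} {w : Fin n → α → ℝ}
    (h : ∀ i, ∑ a, w i a = 1) (f : Fin n → α → ℝ) :
    ∑ ys, prodW w ys * ∑ i, f i (ys i) = ∑ i, ∑ a, w i a * f i a := by
  simp only [Finset.mul_sum]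
  rw [Finset.sum_comm]
  exact Finset.sum_congr rfl fun i _ => prodW_marg h i (f i)

lemma prodW_var {α : Type*} [Fintype α] {n : ℕ} {w : Fin n → α → ℝ}
    (h : ∀ i, ∑ a, w i a = 1) (f : Fin n → α → ℝ) (hf : ∀ i, ∑ a, w i a * f i a = 0) :
    ∑ ys, prodW w ys * (∑ i, f i (ys i)) ^ 2 = ∑ i, ∑ a, w i a * (f i a) ^ 2 := by
  simp only [pow_two, Finset.sum_mul_sum]
  simp only [Finset.mul_sum]
  rw [Finset.sum_comm]
  refine Finset.sum_congr rfl fun i _ => ?_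
  rw [Finset.sum_comm, Finset.sum_eq_single i]
  · exact prodW_marg h i (fun a => f i a * f i a)
  · intro j _ hj
    rw [prodW_marg2 h i j hj.symm (f i) (f j), hf, zero_mul]
  · simp

lemma Pr_nonneg {Ω : Type*} [Fintype Ω] {μ : Ω → ℝ} (h : ∀ x, 0 ≤ μ x) (A : Set Ω) :
    0 ≤ Pr μ A := Finset.sum_nonneg fun x _ => Set.indicator_nonneg (fun x _ => h x) x

lemma Pr_mono {Ω : Type*} [Fintype Ω] {μ : Ω → ℝ} (h : ∀ x, 0 ≤ μ x) {A B : Set Ω}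
    (hAB : A ⊆ B) : Pr μ A ≤ Pr μ B :=
  Finset.sum_le_sum fun x _ => Set.indicator_le_indicator_of_subset hAB (fun x => h x) x

lemma Pr_union_le {Ω : Type*} [Fintype Ω] {μ : Ω → ℝ} (h : ∀ x, 0 ≤ μ x) (A B : Set Ω) :
    Pr μ (A ∪ B) ≤ Pr μ A + Pr μ B := by
  unfold Pr
  rw [← Finset.sum_add_distrib]
  refine Finset.sum_le_sum fun x _ => ?_
  have := h x
  by_cases hA : x ∈ A <;> by_cases hB : x ∈ B <;> simp [hA, hB, this]

lemma Pr_le_one {Ω : Type*} [Fintype Ω] {μ : Ω → ℝ} (h : ∀ x, 0 ≤ μ x) (h1 : ∑ x, μ x = 1)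
    (A : Set Ω) : Pr μ A ≤ 1 := by
  rw [← h1]
  exact Finset.sum_le_sum fun x _ => Set.indicator_le_self' (fun x _ => h x) x

lemma Pr_compl {Ω : Type*} [Fintype Ω] {μ : Ω → ℝ} (h1 : ∑ x, μ x = 1)
    (A : Set Ω) : Pr μ Aᶜ = 1 - Pr μ A := by
  rw [← h1]
  unfold Pr
  rw [← Finset.sum_sub_distrib]
  refine Finset.sum_congr rfl fun x _ => ?_
  by_cases hA : x ∈ A <;> simp [hA]

/-- Generic Markov-type bound. -/
lemma Pr_le_sum {Ω : Type*} [Fintype Ω] {μ : Ω → ℝ} (h : ∀ x, 0 ≤ μ x) (A : Set Ω) (F : Ω → ℝ)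
    (hF : ∀ x, 0 ≤ F x) (hA : ∀ x ∈ A, 1 ≤ F x) : Pr μ A ≤ ∑ x, μ x * F x := by
  unfold Pr
  refine Finset.sum_le_sum fun x _ => ?_
  by_cases hx : x ∈ A
  · simp only [Set.indicator_of_mem hx]
    nlinarith [h x, hA x hx]
  · simp only [Set.indicator_of_notMem hx]
    exact mul_nonneg (h x) (hF x)

lemma iidP_nonneg {α : Type*} [Fintype α] {p : α → ℝ} (h : ∀ a, 0 ≤ p a) (n : ℕ) (xs) :
    0 ≤ iidP p n xs := prodW_nonneg (w := fun _ => p) (fun _ => h) xs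

lemma iidP_sum_one {α : Type*} [Fintype α] {p : α → ℝ} (h : ∑ a, p a = 1) (n : ℕ) :
    ∑ xs, iidP p n xs = 1 := prodW_sum_one (w := fun _ => p) (fun _ => h)

/-- Moderate deviations bound. -/
lemma mod_dev {α : Type*} [Fintype α] (p : α → ℝ) (hp : ∀ a, 0 ≤ p a) (hp1 : ∑ a, p a = 1)
    (g : α → ℝ) (hg : ∑ a, p a * g a = 0) :
    ∃ K > 0, ∃ n₀ : ℕ, ∀ n ≥ n₀,
      Pr (iidP p n) {xs | K * Real.sqrt (n * Real.log n) < ∑ i, g (xs i)} ≤ 1 / n := by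
  obtain ⟨b, hb⟩ : ∃ b, ∀ a, |g a| ≤ b := by
    obtain ⟨b, hb⟩ := (Set.finite_range (fun a => |g a|)).bddAbove
    exact ⟨b, fun a => hb ⟨a, rfl⟩⟩
  have hlim : Filter.Tendsto (fun n : ℕ => Real.log n / n) Filter.atTop (nhds 0) := by
    have := Real.isLittleO_log_id_atTop.tendsto_div_nhds_zero
    exact this.comp tendsto_natCast_atTop_atTop
  have hb2 : (0:ℝ) < 1 / (b ^ 2 + 1) := by positivity
  obtain ⟨n₁, hn₁⟩ := Filter.eventually_atTop.1 (hlim.eventually (gt_mem_nhds hb2))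
  refine ⟨b ^ 2 + 1, by positivity, max n₁ 2, fun n hn => ?_⟩
  have hn1 : n₁ ≤ n := le_trans (le_max_left _ _) hn
  have hn2 : 2 ≤ n := le_trans (le_max_right _ _) hn
  have hnpos : (0:ℝ) < n := by positivity
  have hn2' : (2:ℝ) ≤ n := by exact_mod_cast hn2
  have hlog : 0 < Real.log n := Real.log_pos (by linarith)
  set u := Real.sqrt (Real.log n / n) with hu
  have hu0 : 0 ≤ u := Real.sqrt_nonneg _
  have hu2 : u ^ 2 = Real.log n / n := Real.sq_sqrt (by positivity)
  have hub : u ^ 2 * (b ^ 2 + 1) ≤ 1 := by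
    have := hn₁ n hn1
    rw [hu2]
    rw [lt_div_iff₀ (by positivity)] at this
    exact this.le
  have hus : u * Real.sqrt (n * Real.log n) = Real.log n := by
    rw [hu, ← Real.sqrt_mul (by positivity)]
    rw [show Real.log n / n * (n * Real.log n) = Real.log n ^ 2 by field_simp]
    exact Real.sqrt_sq hlog.le
  have hnu : n * u ^ 2 = Real.log n := by rw [hu2]; field_simp
  have hsmall : ∀ a, |u * g a| ≤ 1 := by
    intro a
    rw [abs_mul, abs_of_nonneg hu0]
    have : (u * |g a|) ^ 2 ≤ 1 := by
      have : |g a| ^ 2 ≤ b ^ 2 := pow_le_pow_left₀ (abs_nonneg _) (hb a) 2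
      rw [mul_pow]
      nlinarith [sq_nonneg u]
    nlinarith [mul_nonneg hu0 (abs_nonneg (g a))]
  have hmgf : ∑ a, p a * Real.exp (u * g a) ≤ Real.exp (u ^ 2 * b ^ 2) := by
    calc ∑ a, p a * Real.exp (u * g a) ≤ ∑ a, p a * (1 + u * g a + u ^ 2 * b ^ 2) := by
          refine Finset.sum_le_sum fun a _ => mul_le_mul_of_nonneg_left ?_ (hp a)
          have h1 := (abs_le.1 (Real.abs_exp_sub_one_sub_id_le (hsmall a))).2
          have : |g a| ^ 2 ≤ b ^ 2 := pow_le_pow_left₀ (abs_nonneg _) (hb a) 2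
          rw [sq_abs] at this
          rw [mul_pow] at h1
          nlinarith [sq_nonneg u]
      _ = 1 + u ^ 2 * b ^ 2 := by
          have : ∀ a, p a * (1 + u * g a + u ^ 2 * b ^ 2)
            = p a * (1 + u ^ 2 * b ^ 2) + u * (p a * g a) := fun a => by ring
          simp only [this, Finset.sum_add_distrib, ← Finset.mul_sum, ← Finset.sum_mul, hg, hp1]
          ring
      _ ≤ _ := by linarith [Real.add_one_le_exp (u ^ 2 * b ^ 2)]
  have hM : ∑ xs, iidP p n xs * ∏ i, Real.exp (u * g (xs i))
      ≤ Real.exp (u ^ 2 * b ^ 2) ^ n := by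
    rw [iidP_eq_prodW, prodW_mul_prod (fun _ => p) (fun _ a => Real.exp (u * g a))]
    simp only [Finset.prod_const, Finset.card_univ, Fintype.card_fin]
    exact pow_le_pow_left₀ (Finset.sum_nonneg fun a _ => mul_nonneg (hp a) (Real.exp_pos _).le)
      hmgf n
  calc Pr (iidP p n) {xs | (b ^ 2 + 1) * Real.sqrt (n * Real.log n) < ∑ i, g (xs i)}
      ≤ ∑ xs, iidP p n xs * (Real.exp (-((b ^ 2 + 1) * Real.log n))
          * ∏ i, Real.exp (u * g (xs i))) := by
        refine Pr_le_sum (iidP_nonneg hp n) _ _ (fun x => ?_) fun xs hxs => ?_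
        · exact mul_nonneg (Real.exp_pos _).le (Finset.prod_nonneg fun _ _ => (Real.exp_pos _).le)
        · rw [← Real.exp_sum, ← Real.exp_add, ← Finset.mul_sum]
          apply Real.one_le_exp
          have h1 : (b ^ 2 + 1) * Real.sqrt (n * Real.log n) ≤ ∑ i, g (xs i) := le_of_lt hxs
          have := mul_le_mul_of_nonneg_left h1 hu0
          have h2 : u * ((b ^ 2 + 1) * Real.sqrt (n * Real.log n)) = (b ^ 2 + 1) * Real.log n := by
            rw [mul_left_comm, hus]
          linarith
    _ = Real.exp (-((b ^ 2 + 1) * Real.log n)) * ∑ xs, iidP p n xs * ∏ i, Real.exp (u * g (xs i)) := by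
        rw [Finset.mul_sum]
        exact Finset.sum_congr rfl fun _ _ => by ring
    _ ≤ Real.exp (-((b ^ 2 + 1) * Real.log n)) * Real.exp (u ^ 2 * b ^ 2) ^ n :=
        mul_le_mul_of_nonneg_left hM (Real.exp_pos _).le
    _ = Real.exp (-Real.log n) := by
        rw [← Real.exp_nat_mul, ← Real.exp_add]
        congr 1
        have : (n:ℝ) * (u ^ 2 * b ^ 2) = Real.log n * b ^ 2 := by rw [← hnu]; ring
        rw [this]; ring
    _ = 1 / n := by rw [Real.exp_neg, Real.exp_log hnpos, one_div]

/-- characteristic function -/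
def chf {α : Type*} [Fintype α] (p g : α → ℝ) (t : ℝ) : ℂ :=
  ∑ a, (p a : ℂ) * Complex.exp (Complex.I * (t * g a : ℝ))

lemma norm_exp_I_mul (x : ℝ) : ‖Complex.exp (Complex.I * (x : ℂ))‖ = 1 := by
  rw [mul_comm]; exact Complex.norm_exp_ofReal_mul_I x

lemma chf_norm_le {α : Type*} [Fintype α] (p g : α → ℝ) (hp : ∀ a, 0 ≤ p a)
    (hp1 : ∑ a, p a = 1) (t : ℝ) : ‖chf p g t‖ ≤ 1 := by
  unfold chf
  refine (norm_sum_le _ _).trans ?_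
  rw [← hp1]
  refine Finset.sum_le_sum fun a _ => ?_
  rw [norm_mul, norm_exp_I_mul, mul_one, Complex.norm_real, Real.norm_eq_abs, abs_of_nonneg (hp a)]

lemma chf_local {α : Type*} [Fintype α] (p : α → ℝ) (hp : ∀ a, 0 ≤ p a) (hp1 : ∑ a, p a = 1)
    (g : α → ℝ) (hg : ∑ a, p a * g a = 0) (V : ℝ) (hV : V = ∑ a, p a * g a ^ 2) (hVpos : 0 < V) :
    ∃ t₀ > 0, ∃ C ≥ 0, ∀ t : ℝ, |t| ≤ t₀ →
      ‖chf p g t - (Real.exp (-(V * t ^ 2 / 2)) : ℂ)‖ ≤ C * |t| ^ 3 ∧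
      ‖chf p g t‖ ≤ Real.exp (-(V * t ^ 2 / 4)) := by
  obtain ⟨b, hb1, hb⟩ : ∃ b : ℝ, 1 ≤ b ∧ ∀ a, |g a| ≤ b := by
    obtain ⟨b, hb⟩ := (Set.finite_range (fun a => |g a|)).bddAbove
    exact ⟨max b 1, le_max_right _ _, fun a => (hb ⟨a, rfl⟩).trans (le_max_left _ _)⟩
  have hb0 : 0 < b := by linarith
  have hVb : V ≤ b ^ 2 := by
    rw [hV]
    calc ∑ a, p a * g a ^ 2 ≤ ∑ a, p a * b ^ 2 := by
          refine Finset.sum_le_sum fun a _ => mul_le_mul_of_nonneg_left ?_ (hp a)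
          rw [← sq_abs]
          exact pow_le_pow_left₀ (abs_nonneg _) (hb a) 2
      _ = b ^ 2 := by rw [← Finset.sum_mul, hp1, one_mul]
  refine ⟨min (1 / b) (V / (4 * b ^ 3)), by positivity, 2 * b ^ 3, by positivity, fun t ht => ?_⟩
  have ht1 : |t| * b ≤ 1 := by
    have := ht.trans (min_le_left _ _)
    rwa [le_div_iff₀ hb0] at this
  have ht2 : b ^ 3 * |t| ≤ V / 4 := by
    have := ht.trans (min_le_right _ _)
    rw [le_div_iff₀ (by positivity)] at this
    linarith
  have hVt : V * t ^ 2 ≤ 1 := by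
    have : (|t| * b) ^ 2 ≤ 1 := pow_le_one₀ (by positivity) ht1
    rw [mul_pow, sq_abs] at this
    nlinarith [sq_nonneg t]
  have hVt0 : 0 ≤ V * t ^ 2 := by positivity
  have key : ‖chf p g t - ((1 - V * t ^ 2 / 2 : ℝ) : ℂ)‖ ≤ b ^ 3 * |t| ^ 3 := by
    have e1 : ((1 - V * t ^ 2 / 2 : ℝ) : ℂ) = ∑ a, (p a : ℂ) *
        (1 + Complex.I * (t * g a : ℝ) + (Complex.I * (t * g a : ℝ)) ^ 2 / 2) := by
      have h1 : ∀ a, (p a : ℂ) *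
        (1 + Complex.I * (t * g a : ℝ) + (Complex.I * (t * g a : ℝ)) ^ 2 / 2)
          = ((p a : ℝ) : ℂ) + Complex.I * t * ((p a * g a : ℝ) : ℂ)
            - t ^ 2 / 2 * ((p a * g a ^ 2 : ℝ) : ℂ) := by
        intro a
        push_cast
        rw [mul_pow, Complex.I_sq]
        ring
      simp only [h1, Finset.sum_add_distrib, Finset.sum_sub_distrib, ← Finset.mul_sum,
        ← Complex.ofReal_sum, hp1, hg, ← hV]
      push_cast
      ring
    rw [e1, chf, ← Finset.sum_sub_distrib]
    refine (norm_sum_le _ _).trans ?_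
    calc ∑ a, ‖(p a : ℂ) * Complex.exp (Complex.I * (t * g a : ℝ)) - (p a : ℂ) *
        (1 + Complex.I * (t * g a : ℝ) + (Complex.I * (t * g a : ℝ)) ^ 2 / 2)‖
        ≤ ∑ a, p a * (b ^ 3 * |t| ^ 3) := by
          refine Finset.sum_le_sum fun a _ => ?_
          rw [← mul_sub, norm_mul, Complex.norm_real, Real.norm_eq_abs, abs_of_nonneg (hp a)]
          refine mul_le_mul_of_nonneg_left ?_ (hp a)
          have hx : ‖Complex.I * ((t * g a : ℝ) : ℂ)‖ = |t| * |g a| := by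
            rw [norm_mul, Complex.norm_I, one_mul, Complex.norm_real, Real.norm_eq_abs, abs_mul]
          have hx1 : |t| * |g a| ≤ |t| * b := mul_le_mul_of_nonneg_left (hb a) (abs_nonneg _)
          have := Complex.exp_bound (x := Complex.I * ((t * g a : ℝ) : ℂ))
            (by rw [hx]; linarith) (n := 3) (by norm_num)
          rw [hx] at this
          simp only [Finset.sum_range_succ, Finset.sum_range_zero, Nat.factorial] at this
          have h3 : (|t| * |g a|) ^ 3 ≤ (|t| * b) ^ 3 := pow_le_pow_left₀ (by positivity) hx1 3
          have h30 : 0 ≤ (|t| * |g a|) ^ 3 := by positivity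
          norm_num at this
          norm_num
          rw [mul_pow] at h3
          linarith
      _ = _ := by rw [← Finset.sum_mul, hp1, one_mul]
  constructor
  · have h2 : ‖((1 - V * t ^ 2 / 2 : ℝ) : ℂ) - (Real.exp (-(V * t ^ 2 / 2)) : ℂ)‖
        ≤ b ^ 3 * |t| ^ 3 := by
      rw [← Complex.ofReal_sub, Complex.norm_real, Real.norm_eq_abs, abs_sub_comm]
      have := Real.abs_exp_sub_one_sub_id_le (x := -(V * t ^ 2 / 2))
        (by rw [abs_neg, abs_of_nonneg (by positivity)]; linarith)
      have e : Real.exp (-(V * t ^ 2 / 2)) - (1 - V * t ^ 2 / 2)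
        = Real.exp (-(V * t ^ 2 / 2)) - 1 - -(V * t ^ 2 / 2) := by ring
      rw [e]
      refine this.trans ?_
      have h4 : (V * t ^ 2 / 2) ^ 2 ≤ (b ^ 2 * t ^ 2 / 2) ^ 2 := by gcongr
      have h5 : (b ^ 2 * t ^ 2 / 2) ^ 2 = (b ^ 3 * |t| ^ 3) * (|t| * b) / 4 := by
        rw [← sq_abs t]; ring
      have h6 : 0 ≤ b ^ 3 * |t| ^ 3 := by positivity
      rw [neg_sq]
      nlinarith
    calc _ = ‖(chf p g t - ((1 - V * t ^ 2 / 2 : ℝ) : ℂ)) +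
          (((1 - V * t ^ 2 / 2 : ℝ) : ℂ) - (Real.exp (-(V * t ^ 2 / 2)) : ℂ))‖ := by congr 1; ring
      _ ≤ _ := norm_add_le _ _
      _ ≤ _ := by linarith
  · calc ‖chf p g t‖ = ‖(chf p g t - ((1 - V * t ^ 2 / 2 : ℝ) : ℂ))
          + ((1 - V * t ^ 2 / 2 : ℝ) : ℂ)‖ := by congr 1; ring
      _ ≤ _ := norm_add_le _ _
      _ ≤ b ^ 3 * |t| ^ 3 + (1 - V * t ^ 2 / 2) := by
          refine add_le_add key ?_
          rw [Complex.norm_real, Real.norm_eq_abs, abs_of_nonneg (by linarith)]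
      _ ≤ 1 - V * t ^ 2 / 4 := by
          have : b ^ 3 * |t| ^ 3 = (b ^ 3 * |t|) * t ^ 2 := by rw [← sq_abs t]; ring
          rw [this]
          nlinarith [sq_nonneg t]
      _ ≤ _ := by linarith [Real.add_one_le_exp (-(V * t ^ 2 / 4))]

lemma norm_pow_sub_pow_le' (x y : ℂ) (r : ℝ) (hx : ‖x‖ ≤ r) (hy : ‖y‖ ≤ r) (n : ℕ) :
    ‖x ^ (n + 1) - y ^ (n + 1)‖ ≤ (n + 1) * ‖x - y‖ * r ^ n := by
  have hr : 0 ≤ r := (norm_nonneg x).trans hx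
  induction n with
  | zero => simp
  | succ n ih =>
    have e : x ^ (n + 1 + 1) - y ^ (n + 1 + 1)
      = x * (x ^ (n + 1) - y ^ (n + 1)) + (x - y) * y ^ (n + 1) := by ring
    rw [e]
    refine (norm_add_le _ _).trans ?_
    rw [norm_mul, norm_mul, norm_pow]
    have h1 : ‖x‖ * ‖x ^ (n + 1) - y ^ (n + 1)‖ ≤ r * ((n + 1) * ‖x - y‖ * r ^ n) :=
      mul_le_mul hx ih (norm_nonneg _) hr
    have h2 : ‖x - y‖ * ‖y‖ ^ (n + 1) ≤ ‖x - y‖ * r ^ (n + 1) := by gcongr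
    push_cast
    calc _ ≤ r * ((n + 1) * ‖x - y‖ * r ^ n) + ‖x - y‖ * r ^ (n + 1) := add_le_add h1 h2
      _ = _ := by ring

/-- Gaussian density with variance v -/
def gdv (v x : ℝ) : ℝ := Real.exp (-(x ^ 2 / (2 * v))) / Real.sqrt (2 * Real.pi * v)

lemma gdv_fourier (v : ℝ) (hv : 0 < v) (x : ℝ) :
    ∫ t : ℝ, Complex.exp (Complex.I * ((t * x : ℝ) : ℂ)) * ((Real.exp (-(v * t ^ 2 / 2)) : ℝ) : ℂ)
      = ((2 * Real.pi * gdv v x : ℝ) : ℂ) := by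
  have := fourierIntegral_gaussian (b := ((v / 2 : ℝ) : ℂ)) (by simpa using hv) (x : ℂ)
  have e : ∀ t : ℝ, Complex.exp (Complex.I * ((t * x : ℝ) : ℂ)) *
      ((Real.exp (-(v * t ^ 2 / 2)) : ℝ) : ℂ) =
      Complex.exp (Complex.I * x * t) * Complex.exp (-((v / 2 : ℝ) : ℂ) * (t : ℂ) ^ 2) := by
    intro t
    push_cast
    congr 2 <;> ring
  simp only [e]
  rw [this]
  have e2 : ((Real.pi : ℂ) / ((v / 2 : ℝ) : ℂ)) ^ (1 / 2 : ℂ)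
      = ((Real.sqrt (2 * Real.pi / v) : ℝ) : ℂ) := by
    rw [Real.sqrt_eq_rpow, Complex.ofReal_cpow (by positivity)]
    push_cast
    congr 1
    field_simp
  rw [e2]
  have e3 : Complex.exp (-(x : ℂ) ^ 2 / (4 * ((v / 2 : ℝ) : ℂ)))
      = ((Real.exp (-(x ^ 2 / (2 * v))) : ℝ) : ℂ) := by
    push_cast
    congr 1
    have : (v : ℂ) ≠ 0 := by exact_mod_cast hv.ne'
    field_simp
    ring
  rw [e3, ← Complex.ofReal_mul]
  congr 1
  unfold gdv
  have h1 : Real.sqrt (2 * Real.pi / v) * Real.sqrt (2 * Real.pi * v) = 2 * Real.pi := by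
    rw [← Real.sqrt_mul (by positivity)]
    rw [show 2 * Real.pi / v * (2 * Real.pi * v) = (2 * Real.pi) ^ 2 by field_simp]
    exact Real.sqrt_sq (by positivity)
  have h2 : 0 < Real.sqrt (2 * Real.pi * v) := by positivity
  field_simp
  linarith

lemma gdv_fourier_int (v : ℝ) (hv : 0 < v) (x : ℝ) : MeasureTheory.Integrable
    (fun t : ℝ => Complex.exp (Complex.I * ((t * x : ℝ) : ℂ)) *
      ((Real.exp (-(v * t ^ 2 / 2)) : ℝ) : ℂ)) := by
  have := integrable_cexp_quadratic (b := ((v / 2 : ℝ) : ℂ)) (by simpa using hv)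
    (Complex.I * x) 0
  refine this.congr (Filter.Eventually.of_forall fun t => ?_)
  simp only []
  rw [Complex.ofReal_exp, ← Complex.exp_add]
  congr 1
  push_cast
  ring

lemma chf_pow {α : Type*} [Fintype α] (p g : α → ℝ) (n : ℕ) (t : ℝ) :
    chf p g t ^ n = ∑ xs : Fin n → α, (iidP p n xs : ℂ) *
      Complex.exp (Complex.I * ((t * ∑ i, g (xs i) : ℝ) : ℂ)) := by
  have := prod_sum_gen (n := n) (fun _ a => (p a : ℂ) * Complex.exp (Complex.I * (t * g a : ℝ)))
  simp only [Finset.prod_const, Finset.card_univ, Fintype.card_fin] at this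
  rw [chf, ← this]
  refine Finset.sum_congr rfl fun xs _ => ?_
  rw [Finset.prod_mul_distrib, iidP, ← Complex.exp_sum]
  push_cast
  simp only [Finset.mul_sum]

/-- smoothed density -/
def fS {α : Type*} [Fintype α] (p g : α → ℝ) (n : ℕ) (v z : ℝ) : ℝ :=
  ∑ xs : Fin n → α, iidP p n xs * gdv v (∑ i, g (xs i) - z)

lemma fS_diff_eq {α : Type*} [Fintype α] (p g : α → ℝ) (n : ℕ) (v V z : ℝ) (hv : 0 < v)
    (hV : 0 < V) :
    ((2 * Real.pi * (fS p g n v z - gdv (n * V + v) z) : ℝ) : ℂ) =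
      ∫ t : ℝ, Complex.exp (Complex.I * ((t * (-z) : ℝ) : ℂ)) *
        ((chf p g t ^ n - ((Real.exp (-(V * t ^ 2 / 2)) : ℝ) : ℂ) ^ n) *
          ((Real.exp (-(v * t ^ 2 / 2)) : ℝ) : ℂ)) := by
  have hnv : 0 < n * V + v := by positivity
  have i1 : MeasureTheory.Integrable (fun t : ℝ => ∑ xs : Fin n → α, (iidP p n xs : ℂ) *
      (Complex.exp (Complex.I * ((t * (∑ i, g (xs i) - z) : ℝ) : ℂ)) *
        ((Real.exp (-(v * t ^ 2 / 2)) : ℝ) : ℂ))) :=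
    MeasureTheory.integrable_finsetSum _ fun xs _ => (gdv_fourier_int v hv _).const_mul _
  have i2 := gdv_fourier_int (n * V + v) hnv (-z)
  have e : ∀ t : ℝ, Complex.exp (Complex.I * ((t * (-z) : ℝ) : ℂ)) *
        ((chf p g t ^ n - ((Real.exp (-(V * t ^ 2 / 2)) : ℝ) : ℂ) ^ n) *
          ((Real.exp (-(v * t ^ 2 / 2)) : ℝ) : ℂ))
      = (∑ xs : Fin n → α, (iidP p n xs : ℂ) *
      (Complex.exp (Complex.I * ((t * (∑ i, g (xs i) - z) : ℝ) : ℂ)) *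
        ((Real.exp (-(v * t ^ 2 / 2)) : ℝ) : ℂ))) -
        Complex.exp (Complex.I * ((t * (-z) : ℝ) : ℂ)) *
          ((Real.exp (-((n * V + v) * t ^ 2 / 2)) : ℝ) : ℂ) := by
    intro t
    rw [sub_mul, mul_sub]
    congr 1
    · rw [chf_pow, Finset.sum_mul, Finset.mul_sum]
      refine Finset.sum_congr rfl fun xs _ => ?_
      have : Complex.exp (Complex.I * ((t * (∑ i, g (xs i) - z) : ℝ) : ℂ))
        = Complex.exp (Complex.I * ((t * (-z) : ℝ) : ℂ)) *
          Complex.exp (Complex.I * ((t * ∑ i, g (xs i) : ℝ) : ℂ)) := by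
        rw [← Complex.exp_add]
        congr 1
        push_cast
        ring
      rw [this]
      ring
    · congr 1
      rw [← Complex.ofReal_pow, ← Complex.ofReal_mul, ← Real.exp_nat_mul, ← Real.exp_add]
      congr 2
      ring
  simp only [e]
  rw [MeasureTheory.integral_sub i1 i2, MeasureTheory.integral_finsetSum, gdv_fourier _ hnv]
  · simp only [MeasureTheory.integral_const_mul, gdv_fourier v hv]
    have : gdv (n * V + v) (-z) = gdv (n * V + v) z := by simp [gdv]
    rw [this, fS, mul_sub, Finset.mul_sum]
    push_cast
    congr 1
    refine Finset.sum_congr rfl fun xs _ => ?_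
    ring
  · exact fun xs _ => (gdv_fourier_int v hv _).const_mul _

lemma cube_exp_bound (α t : ℝ) (hα : 0 < α) :
    |t| ^ 3 * Real.exp (-(2 * α ^ 2 * t ^ 2)) ≤ 3 / α ^ 3 * Real.exp (-α ^ 2 * t ^ 2) := by
  have h1 : (α * |t|) ^ 3 ≤ 3 * Real.exp (α ^ 2 * t ^ 2) := by
    set u := α * |t|
    have hu : 0 ≤ u := by positivity
    have h2 : α ^ 2 * t ^ 2 = u ^ 2 := by rw [← sq_abs t]; ring
    rw [h2]
    have := Real.pow_div_factorial_le_exp (u ^ 2) (by positivity) 2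
    norm_num at this
    have h3 := Real.one_le_exp (sq_nonneg u)
    have : u ^ 3 ≤ 1 + (u ^ 2) ^ 2 := by nlinarith [sq_nonneg (u - 1), sq_nonneg (u ^ 2 - u), sq_nonneg (u^2-1)]
    linarith
  have e : Real.exp (-α ^ 2 * t ^ 2) = Real.exp (-(2 * α ^ 2 * t ^ 2)) * Real.exp (α ^ 2 * t ^ 2) := by
    rw [← Real.exp_add]; congr 1; ring
  rw [e]
  rw [mul_pow] at h1
  rw [div_mul_eq_mul_div, le_div_iff₀ (by positivity)]
  nlinarith [Real.exp_pos (-(2 * α ^ 2 * t ^ 2))]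

lemma fS_diff_bound {α : Type*} [Fintype α] (p : α → ℝ) (hp : ∀ a, 0 ≤ p a) (hp1 : ∑ a, p a = 1)
    (g : α → ℝ) (hg : ∑ a, p a * g a = 0) (V : ℝ) (hV : V = ∑ a, p a * g a ^ 2) (hVpos : 0 < V) :
    ∃ K > 0, ∃ C > 0, ∀ n : ℕ, 3 ≤ n → ∀ z,
      |fS p g n (K * Real.log n) z - gdv (n * V + K * Real.log n) z| ≤ C / n := by
  obtain ⟨t₀, ht₀, C, hC, hloc⟩ := chf_local p hp hp1 g hg V hV hVpos
  refine ⟨4 / t₀ ^ 2, by positivity,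
    C * 3 * Real.sqrt Real.pi * (256 / V ^ 2) + 2 * Real.sqrt (Real.pi * t₀ ^ 2) , by positivity, fun n hn z => ?_⟩
  obtain ⟨m, rfl⟩ : ∃ m, n = m + 1 := ⟨n - 1, by omega⟩
  have hm : (2:ℝ) ≤ m := by exact_mod_cast (by omega : 2 ≤ m)
  set N : ℝ := ((m + 1 : ℕ) : ℝ) with hN
  have hNm : N = m + 1 := by rw [hN]; push_cast; ring
  have hN3 : 3 ≤ N := by linarith
  have hlog : 1 ≤ Real.log N := by
    rw [Real.le_log_iff_exp_le (by linarith)]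
    linarith [Real.exp_one_lt_d9]
  set v := 4 / t₀ ^ 2 * Real.log N with hv
  have hvpos : 0 < v := by positivity
  set a := Real.sqrt (m * V / 8) with ha
  have hapos : 0 < a := by positivity
  have ha2 : a ^ 2 = m * V / 8 := Real.sq_sqrt (by positivity)
  have hpt : ∀ t : ℝ, ‖Complex.exp (Complex.I * ((t * (-z) : ℝ) : ℂ)) *
        ((chf p g t ^ (m+1) - ((Real.exp (-(V * t ^ 2 / 2)) : ℝ) : ℂ) ^ (m+1)) *
          ((Real.exp (-(v * t ^ 2 / 2)) : ℝ) : ℂ))‖ ≤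
        N * C * (3 / a ^ 3) * Real.exp (-a ^ 2 * t ^ 2) + 2 / N * Real.exp (-(v / 4) * t ^ 2) := by
    intro t
    rw [norm_mul, norm_exp_I_mul, one_mul, norm_mul, Complex.norm_real, Real.norm_eq_abs,
      abs_of_pos (Real.exp_pos _)]
    by_cases ht : |t| ≤ t₀
    · obtain ⟨h1, h2⟩ := hloc t ht
      have h3 : ‖((Real.exp (-(V * t ^ 2 / 2)) : ℝ) : ℂ)‖ ≤ Real.exp (-(V * t ^ 2 / 4)) := by
        rw [Complex.norm_real, Real.norm_eq_abs, abs_of_pos (Real.exp_pos _)]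
        apply Real.exp_le_exp.2
        have : 0 ≤ V * t ^ 2 := by positivity
        linarith
      have h4 := norm_pow_sub_pow_le' _ _ _ h2 h3 m
      have h5 : Real.exp (-(v * t ^ 2 / 2)) ≤ 1 := by
        apply Real.exp_le_one_iff.2
        have : 0 ≤ v * t ^ 2 := by positivity
        linarith
      have h6 : Real.exp (-(V * t ^ 2 / 4)) ^ m = Real.exp (-(2 * a ^ 2 * t ^ 2)) := by
        rw [← Real.exp_nat_mul, ha2]; congr 1; ring
      rw [h6] at h4
      have h7 := cube_exp_bound a t hapos
      calc _ ≤ ‖chf p g t ^ (m+1) - ((Real.exp (-(V * t ^ 2 / 2)) : ℝ) : ℂ) ^ (m+1)‖ * 1 := by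
            gcongr
        _ ≤ (m + 1) * (C * |t| ^ 3) * Real.exp (-(2 * a ^ 2 * t ^ 2)) := by
            rw [mul_one]
            refine h4.trans ?_
            gcongr
        _ = N * C * (|t| ^ 3 * Real.exp (-(2 * a ^ 2 * t ^ 2))) := by rw [hNm]; ring
        _ ≤ N * C * (3 / a ^ 3 * Real.exp (-a ^ 2 * t ^ 2)) := by gcongr
        _ = N * C * (3 / a ^ 3) * Real.exp (-a ^ 2 * t ^ 2) + 0 := by ring
        _ ≤ _ := by gcongr; positivity
    · push Not at ht
      have h1 : ‖chf p g t ^ (m+1) - ((Real.exp (-(V * t ^ 2 / 2)) : ℝ) : ℂ) ^ (m+1)‖ ≤ 2 := by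
        refine (norm_sub_le _ _).trans ?_
        have q1 : ‖chf p g t ^ (m+1)‖ ≤ 1 := by
          rw [norm_pow]; exact pow_le_one₀ (norm_nonneg _) (chf_norm_le p g hp hp1 t)
        have q2 : ‖((Real.exp (-(V * t ^ 2 / 2)) : ℝ) : ℂ) ^ (m+1)‖ ≤ 1 := by
          rw [norm_pow]
          apply pow_le_one₀ (norm_nonneg _)
          rw [Complex.norm_real, Real.norm_eq_abs, abs_of_pos (Real.exp_pos _)]
          apply Real.exp_le_one_iff.2
          have : 0 ≤ V * t ^ 2 := by positivity
          linarith
        linarith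
      have h2 : Real.exp (-(v * t ^ 2 / 2)) ≤ 1 / N * Real.exp (-(v / 4) * t ^ 2) := by
        have : 1 / N = Real.exp (-Real.log N) := by
          rw [Real.exp_neg, Real.exp_log (by linarith), one_div]
        rw [this, ← Real.exp_add]
        apply Real.exp_le_exp.2
        have h3 : t₀ ^ 2 ≤ t ^ 2 := by
          rw [← sq_abs t]; exact pow_le_pow_left₀ ht₀.le ht.le 2
        have h4 : Real.log N = v / 4 * t₀ ^ 2 := by rw [hv]; field_simp
        rw [h4]
        nlinarith
      calc _ ≤ 2 * (1 / N * Real.exp (-(v / 4) * t ^ 2)) := by gcongr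
        _ = 0 + 2 / N * Real.exp (-(v / 4) * t ^ 2) := by ring
        _ ≤ _ := by gcongr; positivity
  have hintg := MeasureTheory.norm_integral_le_of_norm_le (μ := MeasureTheory.volume)
    (((integrable_exp_neg_mul_sq (b := a ^ 2) (by positivity)).const_mul (N * C * (3 / a ^ 3))).add
      ((integrable_exp_neg_mul_sq (b := v / 4) (by positivity)).const_mul (2 / N)))
    (Filter.Eventually.of_forall hpt)
  rw [← fS_diff_eq p g (m+1) v V z hvpos hVpos] at hintg
  have hI : ∫ t : ℝ, ((fun t : ℝ => N * C * (3 / a ^ 3) * Real.exp (-a ^ 2 * t ^ 2)) +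
     (fun t : ℝ => 2 / N * Real.exp (-(v / 4) * t ^ 2)) : ℝ → ℝ) t =
      N * C * (3 / a ^ 3) * Real.sqrt (Real.pi / a ^ 2) + 2 / N * Real.sqrt (Real.pi / (v / 4)) := by
    simp only [Pi.add_apply]
    rw [MeasureTheory.integral_add, MeasureTheory.integral_const_mul,
      MeasureTheory.integral_const_mul, integral_gaussian, integral_gaussian]
    · exact (integrable_exp_neg_mul_sq (b := a ^ 2) (by positivity)).const_mul _
    · exact (integrable_exp_neg_mul_sq (b := v / 4) (by positivity)).const_mul _
  rw [hI, Complex.norm_real, Real.norm_eq_abs, abs_mul, abs_of_pos (by positivity)] at hintg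
  have hpi : 1 ≤ 2 * Real.pi := by linarith [Real.pi_gt_three]
  have b1 : N * C * (3 / a ^ 3) * Real.sqrt (Real.pi / a ^ 2)
      ≤ C * 3 * Real.sqrt Real.pi * (256 / V ^ 2) / N := by
    rw [Real.sqrt_div Real.pi_pos.le, Real.sqrt_sq hapos.le]
    have e : N * C * (3 / a ^ 3) * (Real.sqrt Real.pi / a)
      = C * 3 * Real.sqrt Real.pi * (N / (a ^ 2) ^ 2) := by field_simp
    rw [e, mul_div_assoc]
    refine mul_le_mul_of_nonneg_left ?_ (by positivity)
    rw [ha2, div_div, div_le_div_iff₀ (by positivity) (by positivity)]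
    have : N ≤ 2 * m := by linarith
    have : N ^ 2 ≤ (2 * m) ^ 2 := by gcongr
    nlinarith [sq_nonneg V]
  have b2 : 2 / N * Real.sqrt (Real.pi / (v / 4)) ≤ 2 * Real.sqrt (Real.pi * t₀ ^ 2) / N := by
    rw [div_mul_eq_mul_div]
    gcongr
    rw [hv]
    rw [show Real.pi / (4 / t₀ ^ 2 * Real.log N / 4) = Real.pi * t₀ ^ 2 / Real.log N by field_simp]
    exact div_le_self (by positivity) hlog
  rw [add_div]
  have := abs_nonneg (fS p g (m + 1) v z - gdv (↑(m + 1) * V + v) z)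
  nlinarith

lemma gauss_density_integrable : MeasureTheory.Integrable
    (fun u : ℝ => Real.exp (-u ^ 2 / 2) / Real.sqrt (2 * Real.pi)) := by
  have := (integrable_exp_neg_mul_sq (b := 1 / 2) (by norm_num)).div_const (Real.sqrt (2 * Real.pi))
  refine this.congr (Filter.Eventually.of_forall fun t => ?_)
  simp only []
  congr 2
  ring

lemma gauss_density_total :
    ∫ u : ℝ, Real.exp (-u ^ 2 / 2) / Real.sqrt (2 * Real.pi) = 1 := by
  have : ∀ u : ℝ, -u ^ 2 / 2 = -(1/2) * u ^ 2 := fun u => by ring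
  simp only [this]
  rw [MeasureTheory.integral_div, integral_gaussian]
  rw [show Real.pi / (1 / 2) = 2 * Real.pi by ring]
  exact div_self (by positivity)

lemma gaussQ_sub (a b : ℝ) (_hab : a ≤ b) :
    gaussQ a - gaussQ b = ∫ u in a..b, Real.exp (-u ^ 2 / 2) / Real.sqrt (2 * Real.pi) := by
  unfold gaussQ
  rw [sub_eq_iff_eq_add]
  exact (intervalIntegral.integral_interval_add_Ioi gauss_density_integrable.integrableOn
    gauss_density_integrable.integrableOn).symm

lemma gauss_density_le (u : ℝ) : Real.exp (-u ^ 2 / 2) / Real.sqrt (2 * Real.pi) ≤ 1 := by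
  rw [div_le_one (by positivity)]
  have h1 : Real.exp (-u ^ 2 / 2) ≤ 1 := Real.exp_le_one_iff.2 (by nlinarith [sq_nonneg u])
  refine h1.trans ?_
  rw [Real.one_le_sqrt]
  linarith [Real.pi_gt_three]

lemma gauss_density_cont :
    Continuous (fun u : ℝ => Real.exp (-u ^ 2 / 2) / Real.sqrt (2 * Real.pi)) := by fun_prop

lemma gaussQ_anti {a b : ℝ} (hab : a ≤ b) : gaussQ b ≤ gaussQ a := by
  have := gaussQ_sub a b hab
  have h2 : 0 ≤ ∫ u in a..b, Real.exp (-u ^ 2 / 2) / Real.sqrt (2 * Real.pi) :=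
    intervalIntegral.integral_nonneg hab fun u _ => by positivity
  linarith

lemma gaussQ_lip (a b : ℝ) : gaussQ a ≤ gaussQ b + |a - b| := by
  rcases le_total a b with h | h
  · have h1 := gaussQ_sub a b h
    have h2 : ∫ u in a..b, Real.exp (-u ^ 2 / 2) / Real.sqrt (2 * Real.pi) ≤ ∫ u in a..b, (1:ℝ) :=
      intervalIntegral.integral_mono_on h (gauss_density_cont.intervalIntegrable _ _)
        (by simp) fun u _ => gauss_density_le u
    rw [intervalIntegral.integral_const, smul_eq_mul, mul_one] at h2
    rw [abs_sub_comm, abs_of_nonneg (by linarith)]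
    linarith
  · have := gaussQ_anti h
    have := abs_nonneg (a - b)
    linarith

lemma gaussQ_neg (t : ℝ) : gaussQ (-t) = 1 - gaussQ t := by
  have h1 : gaussQ (-t) = ∫ u in Set.Iic t, Real.exp (-u ^ 2 / 2) / Real.sqrt (2 * Real.pi) := by
    unfold gaussQ
    rw [← integral_comp_neg_Iic]
    simp
  rw [h1, ← gauss_density_total]
  unfold gaussQ
  rw [eq_sub_iff_add_eq]
  exact intervalIntegral.integral_Iic_add_Ioi gauss_density_integrable.integrableOn
    gauss_density_integrable.integrableOn

lemma gaussQ_slope (z : ℝ) : ∃ c > 0, ∀ h, 0 ≤ h → h ≤ 1 →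
    gaussQ z + c * h ≤ gaussQ (z - h) ∧ gaussQ (z + h) ≤ gaussQ z - c * h := by
  refine ⟨Real.exp (-(|z| + 1) ^ 2 / 2) / Real.sqrt (2 * Real.pi), by positivity, ?_⟩
  have main : ∀ a b, a ≤ b → (∀ u ∈ Set.Icc a b, |u| ≤ |z| + 1) →
      Real.exp (-(|z| + 1) ^ 2 / 2) / Real.sqrt (2 * Real.pi) * (b - a) ≤ gaussQ a - gaussQ b := by
    intro a b hab hu
    rw [gaussQ_sub a b hab]
    have : ∫ u in a..b, Real.exp (-(|z| + 1) ^ 2 / 2) / Real.sqrt (2 * Real.pi) ≤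
        ∫ u in a..b, Real.exp (-u ^ 2 / 2) / Real.sqrt (2 * Real.pi) := by
      refine intervalIntegral.integral_mono_on hab (by simp)
        (gauss_density_cont.intervalIntegrable _ _) fun u hu' => ?_
      refine div_le_div_of_nonneg_right (Real.exp_le_exp.2 ?_) (by positivity)
      have := pow_le_pow_left₀ (abs_nonneg _) (hu u hu') 2
      rw [sq_abs] at this
      linarith
    rw [intervalIntegral.integral_const, smul_eq_mul] at this
    linarith
  intro h h0 h1
  have hz := abs_le.1 (le_refl |z|)
  constructor
  · have := main (z - h) z (by linarith) (fun u hu => abs_le.2 ⟨by linarith [hu.1], by linarith [hu.2]⟩)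
    rw [show z - (z - h) = h by ring] at this
    linarith
  · have := main z (z + h) (by linarith) (fun u hu => abs_le.2 ⟨by linarith [hu.1], by linarith [hu.2]⟩)
    rw [show z + h - z = h by ring] at this
    linarith

lemma gdv_cont (v : ℝ) : Continuous (gdv v) := by unfold gdv; fun_prop

lemma gdv_nonneg (v x : ℝ) : 0 ≤ gdv v x := by unfold gdv; positivity

lemma gdv_integrable (v : ℝ) (hv : 0 < v) : MeasureTheory.Integrable (gdv v) := by
  have := (integrable_exp_neg_mul_sq (b := 1 / (2 * v)) (by positivity)).div_const
    (Real.sqrt (2 * Real.pi * v))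
  refine this.congr (Filter.Eventually.of_forall fun t => ?_)
  simp only [gdv]
  congr 2
  ring

lemma gdv_total (v : ℝ) (hv : 0 < v) : ∫ x, gdv v x = 1 := by
  have : ∀ x, gdv v x = Real.exp (-(1 / (2 * v)) * x ^ 2) / Real.sqrt (2 * Real.pi * v) := by
    intro x; unfold gdv; congr 2; ring
  simp only [this]
  rw [MeasureTheory.integral_div, integral_gaussian]
  rw [show Real.pi / (1 / (2 * v)) = 2 * Real.pi * v by field_simp]
  exact div_self (by positivity)

lemma gdv_interval_le (v : ℝ) (hv : 0 < v) (a b : ℝ) (hab : a ≤ b) :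
    ∫ x in a..b, gdv v x ≤ gaussQ (a / Real.sqrt v) := by
  have hs : 0 < Real.sqrt v := by positivity
  have h1 := MeasureTheory.integral_comp_mul_left_Ioi
    (fun u : ℝ => Real.exp (-u ^ 2 / 2) / Real.sqrt (2 * Real.pi)) a (b := (Real.sqrt v)⁻¹)
    (by positivity)
  have h2 : ∫ x in Set.Ioi a, gdv v x = gaussQ (a / Real.sqrt v) := by
    unfold gaussQ
    rw [show a / Real.sqrt v = (Real.sqrt v)⁻¹ * a by ring]
    have h3 : ∀ x, gdv v x = (Real.sqrt v)⁻¹ * (Real.exp (-((Real.sqrt v)⁻¹ * x) ^ 2 / 2)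
      / Real.sqrt (2 * Real.pi)) := by
      intro x
      unfold gdv
      rw [Real.sqrt_mul (by positivity) v]
      have : -((Real.sqrt v)⁻¹ * x) ^ 2 / 2 = -(x ^ 2 / (2 * v)) := by
        rw [mul_pow, inv_pow, Real.sq_sqrt hv.le]; field_simp
      rw [this]
      field_simp
    simp only [h3]
    rw [MeasureTheory.integral_const_mul, h1, smul_eq_mul, inv_inv, ← mul_assoc,
      inv_mul_cancel₀ hs.ne', one_mul]
  rw [← h2, intervalIntegral.integral_of_le hab]
  exact MeasureTheory.setIntegral_mono_set (gdv_integrable v hv).integrableOn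
    (Filter.Eventually.of_forall fun x => gdv_nonneg v x) (Set.Ioc_subset_Ioi_self.eventuallyLE)

lemma gdv_center (v : ℝ) (hv : 0 < v) (u : ℝ) (hu : 0 ≤ u) :
    1 - Real.sqrt 2 * Real.exp (-(u ^ 2 / (4 * v))) ≤ ∫ x in (-u)..u, gdv v x := by
  have hi := gdv_integrable v hv
  have hi2 := gdv_integrable (2 * v) (by positivity)
  have h1 : ∀ x, gdv v x ≤ (Set.Ioc (-u) u).indicator (gdv v) x +
      Real.sqrt 2 * Real.exp (-(u ^ 2 / (4 * v))) * gdv (2 * v) x := by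
    intro x
    by_cases hx : x ∈ Set.Ioc (-u) u
    · rw [Set.indicator_of_mem hx]
      have := gdv_nonneg (2 * v) x
      have : 0 ≤ Real.sqrt 2 * Real.exp (-(u ^ 2 / (4 * v))) * gdv (2 * v) x := by positivity
      linarith
    · rw [Set.indicator_of_notMem hx, zero_add]
      have hx2 : u ^ 2 ≤ x ^ 2 := by
        rw [Set.mem_Ioc, not_and_or] at hx
        rcases hx with hx | hx <;> nlinarith
      unfold gdv
      rw [show 2 * Real.pi * (2 * v) = 2 * (2 * Real.pi * v) by ring,
        Real.sqrt_mul (by norm_num) (2 * Real.pi * v)]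
      have hs2 : 0 < Real.sqrt 2 := by positivity
      have hs3 : 0 < Real.sqrt (2 * Real.pi * v) := by positivity
      rw [show Real.sqrt 2 * Real.exp (-(u ^ 2 / (4 * v))) *
        (Real.exp (-(x ^ 2 / (2 * (2 * v)))) / (Real.sqrt 2 * Real.sqrt (2 * Real.pi * v)))
        = (Real.exp (-(u ^ 2 / (4 * v))) * Real.exp (-(x ^ 2 / (2 * (2 * v))))) /
          Real.sqrt (2 * Real.pi * v) by field_simp, ← Real.exp_add]
      gcongr
      rw [show x ^ 2 / (2 * v) = x ^ 2 / (4 * v) + x ^ 2 / (2 * (2 * v)) by field_simp; ring]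
      have : u ^ 2 / (4 * v) ≤ x ^ 2 / (4 * v) := by gcongr
      linarith
  have hi3 : MeasureTheory.Integrable ((Set.Ioc (-u) u).indicator (gdv v)) :=
    hi.indicator measurableSet_Ioc
  have h2 := MeasureTheory.integral_mono hi (hi3.add (hi2.const_mul _)) h1
  simp only [Pi.add_apply] at h2
  rw [MeasureTheory.integral_add hi3 (hi2.const_mul _), MeasureTheory.integral_const_mul,
    gdv_total v hv, gdv_total _ (by positivity), MeasureTheory.integral_indicator measurableSet_Ioc,
    ← intervalIntegral.integral_of_le (by linarith)] at h2
  linarith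

lemma fS_cont {α : Type*} [Fintype α] (p g : α → ℝ) (n : ℕ) (v : ℝ) : Continuous (fS p g n v) := by
  unfold fS
  refine continuous_finsetSum _ fun xs _ => continuous_const.mul ?_
  exact (gdv_cont v).comp (by fun_prop)

lemma fS_interval {α : Type*} [Fintype α] (p g : α → ℝ) (hp : ∀ a, 0 ≤ p a) (n : ℕ) (v : ℝ)
    (hv : 0 < v) (z L u : ℝ) (hu : 0 ≤ u) (hzL : z ≤ L) :
    Pr (iidP p n) {xs | z < ∑ i, g (xs i) ∧ ∑ i, g (xs i) ≤ L} *
      (1 - Real.sqrt 2 * Real.exp (-(u ^ 2 / (4 * v)))) ≤ ∫ x in (z - u)..(L + u), fS p g n v x := by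
  unfold fS
  rw [intervalIntegral.integral_finsetSum]
  · unfold Pr
    rw [Finset.sum_mul]
    refine Finset.sum_le_sum fun xs _ => ?_
    rw [intervalIntegral.integral_const_mul]
    set S := ∑ i, g (xs i) with hS
    have e : ∫ x in (z - u)..(L + u), gdv v (S - x) = ∫ x in (S - (L + u))..(S - (z - u)), gdv v x :=
      intervalIntegral.integral_comp_sub_left (fun x => gdv v x) S
    rw [e]
    have hp' := iidP_nonneg hp n xs
    by_cases hx : z < S ∧ S ≤ L
    · rw [Set.indicator_of_mem (by exact hx)]
      refine mul_le_mul_of_nonneg_left ?_ hp'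
      refine (gdv_center v hv u hu).trans ?_
      refine intervalIntegral.integral_mono_interval (by linarith) (by linarith) (by linarith)
        (Filter.Eventually.of_forall fun x => gdv_nonneg v x)
        ((gdv_cont v).intervalIntegrable _ _)
    · rw [Set.indicator_of_notMem (by exact hx), zero_mul]
      refine mul_nonneg hp' (intervalIntegral.integral_nonneg (by linarith) fun x _ => gdv_nonneg v x)
  · intro xs _
    refine Continuous.intervalIntegrable ?_ _ _
    exact continuous_const.mul ((gdv_cont v).comp (by fun_prop))

set_option maxHeartbeats 1000000 in
lemma be_upper {α : Type*} [Fintype α] (p : α → ℝ) (hp : ∀ a, 0 ≤ p a) (hp1 : ∑ a, p a = 1)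
    (g : α → ℝ) (hg : ∑ a, p a * g a = 0) (V : ℝ) (hV : V = ∑ a, p a * g a ^ 2) (hVpos : 0 < V)
    (A : ℝ) (hA : 0 < A) :
    ∃ C > 0, ∃ n₀ : ℕ, ∀ n ≥ n₀, ∀ z : ℝ, |z| ≤ A * Real.sqrt n →
      Pr (iidP p n) {xs | z < ∑ i, g (xs i)} ≤
        gaussQ (z / Real.sqrt (n * V)) + C * (Real.log n / Real.sqrt n) := by
  obtain ⟨K, hK, C, hC, hdiff⟩ := fS_diff_bound p hp hp1 g hg V hV hVpos
  obtain ⟨K1, hK1, n₁, hdev⟩ := mod_dev p hp hp1 g hg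
  refine ⟨(2 * Real.sqrt K / Real.sqrt V + A * K / (Real.sqrt V * V)) +
    C * (K1 + 4 * Real.sqrt K + A + A) + 2 + 1, by positivity, max n₁ 3, fun n hn z hz => ?_⟩
  have hn1 : n₁ ≤ n := le_trans (le_max_left _ _) hn
  have hn3 : 3 ≤ n := le_trans (le_max_right _ _) hn
  have hN3 : (3:ℝ) ≤ n := by exact_mod_cast hn3
  have hN0 : (0:ℝ) < n := by linarith
  have hlog : 1 ≤ Real.log n := by
    rw [Real.le_log_iff_exp_le (by linarith)]
    linarith [Real.exp_one_lt_d9]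
  set l := Real.log n with hl
  set r := Real.sqrt n with hr
  have hr2 : r ^ 2 = n := Real.sq_sqrt hN0.le
  have hr1 : 1 ≤ r := by rw [hr, Real.one_le_sqrt]; linarith
  have hr0 : 0 < r := by linarith
  set v := K * l with hv
  have hvpos : 0 < v := by positivity
  set L := max (K1 * Real.sqrt (n * l)) z with hL
  set u := 2 * Real.sqrt K * l with hu
  have hu0 : 0 ≤ u := by positivity
  have hz' := abs_le.1 hz
  have hLb : L ≤ (K1 + A) * (r * l) := by
    apply max_le
    · have : Real.sqrt (n * l) ≤ r * l := by
        rw [Real.sqrt_mul hN0.le]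
        gcongr
        rw [Real.sqrt_le_left (by linarith)]
        nlinarith
      have h2 : 0 ≤ A * (r * l) := by positivity
      nlinarith
    · have : r ≤ r * l := le_mul_of_one_le_right hr0.le hlog
      have h2 : 0 ≤ K1 * (r * l) := by positivity
      nlinarith [hz'.2]
  -- tail
  have h1 : Pr (iidP p n) {xs | z < ∑ i, g (xs i)} ≤
      Pr (iidP p n) {xs | z < ∑ i, g (xs i) ∧ ∑ i, g (xs i) ≤ L} + 1 / n := by
    have hsub : {xs : Fin n → α | z < ∑ i, g (xs i)} ⊆
      {xs | z < ∑ i, g (xs i) ∧ ∑ i, g (xs i) ≤ L} ∪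
        {xs | K1 * Real.sqrt (n * Real.log n) < ∑ i, g (xs i)} := by
      intro xs hxs
      by_cases h : ∑ i, g (xs i) ≤ L
      · exact Or.inl ⟨hxs, h⟩
      · push Not at h
        exact Or.inr (lt_of_le_of_lt (le_max_left _ _) h)
    exact (Pr_mono (iidP_nonneg hp n) hsub).trans
      ((Pr_union_le (iidP_nonneg hp n) _ _).trans (by linarith [hdev n hn1]))
  have h2 := fS_interval p g hp n v hvpos z L u hu0 (le_max_right _ _)
  have hexp : Real.exp (-(u ^ 2 / (4 * v))) = 1 / n := by
    have : u ^ 2 / (4 * v) = l := by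
      rw [hu, hv, mul_pow, mul_pow, Real.sq_sqrt hK.le]; field_simp; ring
    rw [this, Real.exp_neg, hl, Real.exp_log hN0, one_div]
  rw [hexp] at h2
  set q := Pr (iidP p n) {xs | z < ∑ i, g (xs i) ∧ ∑ i, g (xs i) ≤ L} with hq
  have hq1 : q ≤ 1 := Pr_le_one (iidP_nonneg hp n) (iidP_sum_one hp1 n) _
  have hle : z - u ≤ L + u := by linarith [le_max_right (K1 * Real.sqrt (n * l)) z]
  have h3 : ∫ x in (z - u)..(L + u), fS p g n v x ≤
      ∫ x in (z - u)..(L + u), (gdv (n * V + v) x + C / n) := by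
    refine intervalIntegral.integral_mono_on hle ((fS_cont p g n v).intervalIntegrable _ _)
      (((gdv_cont _).add continuous_const).intervalIntegrable _ _) fun x _ => ?_
    have := (abs_le.1 (hdiff n hn3 x)).2
    linarith
  rw [intervalIntegral.integral_add ((gdv_cont _).intervalIntegrable _ _) (by simp),
    intervalIntegral.integral_const, smul_eq_mul] at h3
  have h4 := gdv_interval_le (n * V + v) (by positivity) (z - u) (L + u) hle
  have h5 := gaussQ_lip ((z - u) / Real.sqrt (n * V + v)) (z / Real.sqrt (n * V))
  have hlr : 1 / (n:ℝ) ≤ l / r := by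
    rw [← hr2, div_le_div_iff₀ (by positivity) hr0]
    nlinarith
  have h6 : |(z - u) / Real.sqrt (n * V + v) - z / Real.sqrt (n * V)| ≤
      (2 * Real.sqrt K / Real.sqrt V + A * K / (Real.sqrt V * V)) * (l / r) := by
    set s' := Real.sqrt (n * V + v) with hs'
    set s := Real.sqrt (n * V) with hs
    have hsr : s = r * Real.sqrt V := Real.sqrt_mul hN0.le V
    have hs0 : 0 < s := by positivity
    have hs2 : s ^ 2 = n * V := Real.sq_sqrt (by positivity)
    have hs'2 : s' ^ 2 = n * V + v := Real.sq_sqrt (by positivity)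
    have hss : s ≤ s' := Real.sqrt_le_sqrt (by linarith)
    have hs'0 : 0 < s' := by linarith
    have e : (z - u) / s' - z / s = -(u / s') + -(z * ((s' - s) / (s * s'))) := by
      field_simp; ring
    rw [e]
    refine (abs_add_le _ _).trans ?_
    rw [abs_neg, abs_neg, abs_of_nonneg (div_nonneg hu0 hs'0.le : 0 ≤ u / s'), add_mul]
    refine add_le_add ?_ ?_
    · calc u / s' ≤ u / s := by gcongr
        _ = _ := by rw [hu, hsr]; field_simp
    · rw [abs_mul, abs_of_nonneg (div_nonneg (by linarith) (by positivity) : 0 ≤ (s' - s) / (s * s'))]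
      have h7 : (s' - s) / (s * s') ≤ v / (s * s ^ 2) := by
        rw [div_le_div_iff₀ (by positivity) (by positivity)]
        have : s' - s ≤ v / s' := by
          rw [le_div_iff₀ hs'0]; nlinarith
        calc (s' - s) * (s * s ^ 2) ≤ v / s' * (s * s ^ 2) := by gcongr
          _ ≤ v / s' * (s * s' ^ 2) := by gcongr
          _ = v * (s * s') := by field_simp
      calc |z| * ((s' - s) / (s * s')) ≤ (A * r) * (v / (s * s ^ 2)) :=
            mul_le_mul hz h7 (div_nonneg (by linarith) (by positivity)) (by positivity)
        _ = A * K / (Real.sqrt V * V) * (l / n) := by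
            rw [hs2, hsr, hv]; field_simp
        _ ≤ _ := by
            gcongr
            rw [← hr2]; nlinarith
  have h7 : (L + u - (z - u)) * (C / n) ≤ C * (K1 + 4 * Real.sqrt K + A + A) * (l / r) := by
    have a1 : L + u - (z - u) ≤ (K1 + 4 * Real.sqrt K + A + A) * (r * l) := by
      have b1 : 2 * u ≤ 4 * Real.sqrt K * (r * l) := by
        rw [hu]
        have : l ≤ r * l := le_mul_of_one_le_left (by linarith) hr1
        nlinarith [Real.sqrt_nonneg K]
      have b2 : -z ≤ A * (r * l) := by
        have : r ≤ r * l := le_mul_of_one_le_right hr0.le hlog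
        nlinarith [hz'.1]
      simp only [add_mul] at hLb ⊢
      linarith
    calc (L + u - (z - u)) * (C / n) ≤ (K1 + 4 * Real.sqrt K + A + A) * (r * l) * (C / n) := by gcongr
      _ = _ := by rw [← hr2]; field_simp
  have hsq2 : Real.sqrt 2 ≤ 2 := by rw [Real.sqrt_le_left (by norm_num)]; norm_num
  have hq0 : 0 ≤ q := Pr_nonneg (iidP_nonneg hp n) _
  have h8 : q ≤ q * (1 - Real.sqrt 2 * (1 / n)) + 2 * (1 / n) := by
    have : q * (Real.sqrt 2 * (1 / n)) ≤ 1 * (2 * (1 / n)) := by gcongr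
    linarith
  simp only [add_mul] at h6 h7 ⊢
  linarith

/-- Lower Berry-Esseen type bound. -/
lemma be_lower {α : Type*} [Fintype α] (p : α → ℝ) (hp : ∀ a, 0 ≤ p a) (hp1 : ∑ a, p a = 1)
    (g : α → ℝ) (hg : ∑ a, p a * g a = 0) (V : ℝ) (hV : V = ∑ a, p a * g a ^ 2) (hVpos : 0 < V)
    (A : ℝ) (hA : 0 < A) :
    ∃ C > 0, ∃ n₀ : ℕ, ∀ n ≥ n₀, ∀ z : ℝ, |z| ≤ A * Real.sqrt n →
      gaussQ (z / Real.sqrt (n * V)) - C * (Real.log n / Real.sqrt n) ≤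
        Pr (iidP p n) {xs | z ≤ ∑ i, g (xs i)} := by
  obtain ⟨C, hC, n₀, h⟩ := be_upper p hp hp1 (fun a => -g a) (by simp [hg]) V (by simp [hV]) hVpos A hA
  refine ⟨C, hC, n₀, fun n hn z hz => ?_⟩
  have h1 := h n hn (-z) (by simpa using hz)
  have h2 := Pr_compl (iidP_sum_one hp1 n) {xs : Fin n → α | z ≤ ∑ i, g (xs i)}
  have e : {xs : Fin n → α | z ≤ ∑ i, g (xs i)}ᶜ = {xs | -z < ∑ i, -g (xs i)} := by
    ext xs; simp
  rw [neg_div, gaussQ_neg] at h1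
  rw [e] at h2
  linarith

lemma slope_le {f : ℝ → ℝ} {f' L : ℝ} (h : HasDerivAt f f' 0)
    (hL : ∀ t, 0 < t → t < 1 → f t - f 0 ≤ L * t) : f' ≤ L := by
  have h1 := h.hasDerivWithinAt (s := Set.Ioi 0)
  rw [hasDerivWithinAt_iff_tendsto_slope' (by simp)] at h1
  refine le_of_tendsto h1 ?_
  have : Set.Ioo (0:ℝ) 1 ∈ nhdsWithin (0:ℝ) (Set.Ioi 0) := Ioo_mem_nhdsGT one_pos
  filter_upwards [this] with t ht
  rw [slope_def_field, div_le_iff₀ (by linarith [ht.1])]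
  simpa using hL t ht.1 ht.2

lemma tang {a b c : ℝ} (ha : 0 ≤ a) (hb : 0 ≤ b) (hab : b = 0 → a = 0) (hc : 0 < c) :
    a * Real.log c + a - b * c ≤ a * Real.log (a / b) := by
  rcases ha.eq_or_lt with rfl | ha
  · simp; positivity
  have hb' : 0 < b := lt_of_le_of_ne hb fun h => ha.ne' (hab h.symm)
  have h1 := Real.log_le_sub_one_of_pos (show 0 < b * c / a by positivity)
  rw [Real.log_div (by positivity) ha.ne', Real.log_mul hb'.ne' hc.ne'] at h1
  rw [Real.log_div ha.ne' hb'.ne']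
  have h2 := mul_le_mul_of_nonneg_left h1 ha.le
  have : a * (b * c / a - 1) = b * c - a := by field_simp
  nlinarith

lemma gibbs {a b : ℝ} (ha : 0 ≤ a) (hb : 0 ≤ b) (hab : b = 0 → a = 0) :
    a - b ≤ a * Real.log (a / b) := by
  simpa using tang ha hb hab one_pos

lemma gibbs_eq {a b : ℝ} (ha : 0 ≤ a) (hb : 0 < b) 
    (h : a * Real.log (a / b) ≤ a - b) : a = b := by
  rcases ha.eq_or_lt with rfl | ha
  · simp at h; linarith
  by_contra hne
  have h1 := Real.log_lt_sub_one_of_pos (show 0 < b / a by positivity) (by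
    intro h; rw [div_eq_one_iff_eq ha.ne'] at h; exact hne h.symm)
  rw [Real.log_div hb.ne' ha.ne'] at h1
  rw [Real.log_div ha.ne' hb.ne'] at h
  have h2 := mul_lt_mul_of_pos_left h1 ha
  have : a * (b / a - 1) = b - a := by field_simp
  nlinarith

lemma logsum {a0 a1 b0 b1 s t : ℝ} (ha0 : 0 ≤ a0) (ha1 : 0 ≤ a1) (hb0 : 0 ≤ b0) (hb1 : 0 ≤ b1)
    (h0 : b0 = 0 → a0 = 0) (h1 : b1 = 0 → a1 = 0) (hs : 0 < s) (ht : 0 < t) :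
    (s * a0 + t * a1) * Real.log ((s * a0 + t * a1) / (s * b0 + t * b1)) ≤
      s * (a0 * Real.log (a0 / b0)) + t * (a1 * Real.log (a1 / b1)) := by
  rcases (show 0 ≤ s * b0 + t * b1 by positivity).eq_or_lt with hB | hB
  · have e0 : b0 = 0 := by nlinarith [mul_nonneg hs.le hb0, mul_nonneg ht.le hb1]
    have e1 : b1 = 0 := by nlinarith [mul_nonneg hs.le hb0, mul_nonneg ht.le hb1]
    simp [h0 e0, h1 e1]
  rcases (show 0 ≤ s * a0 + t * a1 by positivity).eq_or_lt with hA | hA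
  · have e0 : a0 = 0 := by nlinarith [mul_nonneg hs.le ha0, mul_nonneg ht.le ha1]
    have e1 : a1 = 0 := by nlinarith [mul_nonneg hs.le ha0, mul_nonneg ht.le ha1]
    simp [e0, e1]
  set c := (s * a0 + t * a1) / (s * b0 + t * b1) with hc
  have hcp : 0 < c := by positivity
  have hcc : (s * b0 + t * b1) * c = s * a0 + t * a1 := by rw [hc]; field_simp
  have k0 := mul_le_mul_of_nonneg_left (tang ha0 hb0 h0 hcp) hs.le
  have k1 := mul_le_mul_of_nonneg_left (tang ha1 hb1 h1 hcp) ht.le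
  nlinarith

section KKT
variable {𝒳 Xh : Type*} [Fintype 𝒳] [Fintype Xh]

lemma outMarg_nonneg {P : 𝒳 → ℝ} (hP0 : ∀ x, 0 ≤ P x) {W : 𝒳 → Xh → ℝ} (hW : IsChannel W) (y) :
    0 ≤ outMarg P W y := Finset.sum_nonneg fun x _ => mul_nonneg (hP0 x) ((hW x).1 y)

lemma outMarg_sum {P : 𝒳 → ℝ} (hP1 : ∑ x, P x = 1) {W : 𝒳 → Xh → ℝ} (hW : IsChannel W) :
    ∑ y, outMarg P W y = 1 := by
  unfold outMarg
  rw [Finset.sum_comm]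
  simp [← Finset.mul_sum, (hW _).2, hP1]

lemma outMarg_zero {P : 𝒳 → ℝ} (hP0 : ∀ x, 0 ≤ P x) {W : 𝒳 → Xh → ℝ} (hW : IsChannel W) {y x}
    (h : outMarg P W y = 0) : P x * W x y = 0 := by
  have := (Finset.sum_eq_zero_iff_of_nonneg
    (fun x _ => mul_nonneg (hP0 x) ((hW x).1 y))).1 h
  exact this x (Finset.mem_univ _)

lemma mutInfo_eq (P : 𝒳 → ℝ) (W : 𝒳 → Xh → ℝ) :
    mutInfo P W = ∑ x, ∑ y, P x * W x y * Real.log (W x y / outMarg P W y) := rfl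

lemma mutInfo_nonneg {P : 𝒳 → ℝ} (hP0 : ∀ x, 0 ≤ P x) (hP1 : ∑ x, P x = 1)
    {W : 𝒳 → Xh → ℝ} (hW : IsChannel W) : 0 ≤ mutInfo P W := by
  have h : ∑ x, ∑ y, (P x * W x y - P x * outMarg P W y) = 0 := by
    simp [Finset.sum_sub_distrib, ← Finset.mul_sum, (hW _).2, outMarg_sum hP1 hW]
  rw [← h, mutInfo_eq]
  refine Finset.sum_le_sum fun x _ => Finset.sum_le_sum fun y _ => ?_
  rcases (hP0 x).eq_or_lt with hx | hx
  · simp [← hx]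
  · have := mul_le_mul_of_nonneg_left (gibbs ((hW x).1 y) (outMarg_nonneg hP0 hW y) (fun h => by
      have := outMarg_zero hP0 hW (x := x) h
      rcases mul_eq_zero.1 this with h | h
      · exact absurd h hx.ne'
      · exact h)) hx.le
    linarith

lemma mutInfo_le_div {P : 𝒳 → ℝ} (hP0 : ∀ x, 0 ≤ P x) (hP1 : ∑ x, P x = 1)
    {W : 𝒳 → Xh → ℝ} (hW : IsChannel W) {Q : Xh → ℝ} (hQ0 : ∀ y, 0 ≤ Q y) (hQ1 : ∑ y, Q y = 1)
    (hQ : ∀ x y, Q y = 0 → W x y = 0) :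
    mutInfo P W ≤ ∑ x, ∑ y, P x * W x y * Real.log (W x y / Q y) := by
  have h : ∑ y, (outMarg P W y - Q y) = 0 := by
    simp [Finset.sum_sub_distrib, outMarg_sum hP1 hW, hQ1]
  have h2 : ∑ y, (outMarg P W y - Q y) ≤
      ∑ y, outMarg P W y * Real.log (outMarg P W y / Q y) := by
    refine Finset.sum_le_sum fun y _ => gibbs (outMarg_nonneg hP0 hW y) (hQ0 y) fun h => ?_
    simp [outMarg, hQ _ y h]
  have h3 : ∑ y, outMarg P W y * Real.log (outMarg P W y / Q y) =
      ∑ x, ∑ y, P x * W x y * Real.log (outMarg P W y / Q y) := by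
    rw [Finset.sum_comm]
    refine Finset.sum_congr rfl fun y _ => ?_
    rw [← Finset.sum_mul]; rfl
  have h4 : ∑ x, ∑ y, P x * W x y * Real.log (outMarg P W y / Q y) =
      ∑ x, ∑ y, P x * W x y * Real.log (W x y / Q y) - mutInfo P W := by
    rw [mutInfo_eq, ← Finset.sum_sub_distrib]
    refine Finset.sum_congr rfl fun x _ => ?_
    rw [← Finset.sum_sub_distrib]
    refine Finset.sum_congr rfl fun y _ => ?_
    by_cases h : P x * W x y = 0
    · simp [h]
    have hq : outMarg P W y ≠ 0 := fun h' => h (outMarg_zero hP0 hW h')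
    have hw : W x y ≠ 0 := right_ne_zero_of_mul h
    have hQ' : Q y ≠ 0 := fun h' => hw (hQ x y h')
    rw [Real.log_div hq hQ', Real.log_div hw hQ', Real.log_div hw hq]; ring
  linarith

lemma RDfun_le {P : 𝒳 → ℝ} (hP0 : ∀ x, 0 ≤ P x) (hP1 : ∑ x, P x = 1) {d : 𝒳 → Xh → ℝ} {D : ℝ}
    {W : 𝒳 → Xh → ℝ} (hW : IsChannel W) (hD : ∑ x, ∑ y, P x * W x y * d x y ≤ D) :
    RDfun P d D ≤ mutInfo P W := by
  refine csInf_le ⟨0, ?_⟩ ⟨W, hW, hD, rfl⟩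
  rintro r ⟨W', hW', -, rfl⟩
  exact mutInfo_nonneg hP0 hP1 hW'

lemma mix_channel {W0 W1 : 𝒳 → Xh → ℝ} (h0 : IsChannel W0) (h1 : IsChannel W1) {t : ℝ}
    (ht : 0 < t) (ht1 : t < 1) : IsChannel (fun x y => (1 - t) * W0 x y + t * W1 x y) := by
  intro x
  refine ⟨fun y => ?_, ?_⟩
  · have := (h0 x).1 y; have := (h1 x).1 y
    have : 0 < 1 - t := by linarith
    positivity
  · simp [Finset.sum_add_distrib, ← Finset.mul_sum, (h0 x).2, (h1 x).2]

lemma mutInfo_convex {P : 𝒳 → ℝ} (hP0 : ∀ x, 0 ≤ P x) 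
    {W0 W1 : 𝒳 → Xh → ℝ} (h0 : IsChannel W0) (h1 : IsChannel W1) {t : ℝ}
    (ht : 0 < t) (ht1 : t < 1) :
    mutInfo P (fun x y => (1 - t) * W0 x y + t * W1 x y) ≤
      (1 - t) * mutInfo P W0 + t * mutInfo P W1 := by
  simp only [mutInfo_eq, Finset.mul_sum, ← Finset.sum_add_distrib]
  refine Finset.sum_le_sum fun x _ => Finset.sum_le_sum fun y _ => ?_
  have e : outMarg P (fun x y => (1 - t) * W0 x y + t * W1 x y) y =
      (1 - t) * outMarg P W0 y + t * outMarg P W1 y := by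
    simp only [outMarg, Finset.mul_sum, ← Finset.sum_add_distrib]
    exact Finset.sum_congr rfl fun x _ => by ring
  rw [e]
  rcases (hP0 x).eq_or_lt with hx | hx
  · simp [← hx]
  have key : ∀ {W : 𝒳 → Xh → ℝ}, IsChannel W → outMarg P W y = 0 → W x y = 0 := by
    intro W hW h
    have := outMarg_zero hP0 hW (x := x) h
    rcases mul_eq_zero.1 this with h | h
    · exact absurd h hx.ne'
    · exact h
  have := mul_le_mul_of_nonneg_left (logsum ((h0 x).1 y) ((h1 x).1 y) (outMarg_nonneg hP0 h0 y)
    (outMarg_nonneg hP0 h1 y) (key h0) (key h1) (sub_pos.2 ht1) ht) hx.le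
  linarith

lemma RD_tangent {P : 𝒳 → ℝ} (hP0 : ∀ x, 0 ≤ P x) (hP1 : ∑ x, P x = 1) {d : 𝒳 → Xh → ℝ} {D : ℝ}
    {Wopt : 𝒳 → Xh → ℝ} (hWch : IsChannel Wopt)
    (hWd : (∑ x, ∑ y, P x * Wopt x y * d x y) ≤ D)
    (hWopt : mutInfo P Wopt = RDfun P d D)
    {lam : ℝ} (hlam : HasDerivAt (fun D' => RDfun P d D') (-lam) D)
    {W : 𝒳 → Xh → ℝ} (hW : IsChannel W) :
    RDfun P d D + lam * D ≤ mutInfo P W + lam * ∑ x, ∑ y, P x * W x y * d x y := by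
  set D' := ∑ x, ∑ y, P x * W x y * d x y with hD'
  have h1 : HasDerivAt (fun t : ℝ => D + t * (D' - D)) (D' - D) 0 := by
    simpa using ((hasDerivAt_id (0:ℝ)).mul_const (D' - D)).const_add D
  have h2 : HasDerivAt (fun t : ℝ => RDfun P d (D + t * (D' - D))) (-lam * (D' - D)) 0 := by
    have := HasDerivAt.comp (h₂ := fun D' => RDfun P d D') (h := fun t : ℝ => D + t * (D' - D))
      (0:ℝ) (h₂' := -lam) (h' := D' - D) (by simpa using hlam) h1
    exact this
  have h3 := slope_le (L := mutInfo P W - RDfun P d D) h2 (fun t ht ht1 => by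
    have hc := mix_channel hWch hW ht ht1
    have h4 : ∑ x, ∑ y, P x * ((1 - t) * Wopt x y + t * W x y) * d x y ≤ D + t * (D' - D) := by
      have : ∑ x, ∑ y, P x * ((1 - t) * Wopt x y + t * W x y) * d x y =
        (1 - t) * (∑ x, ∑ y, P x * Wopt x y * d x y) + t * D' := by
        simp only [hD', Finset.mul_sum, ← Finset.sum_add_distrib]
        exact Finset.sum_congr rfl fun x _ => Finset.sum_congr rfl fun y _ => by ring
      rw [this]
      nlinarith
    have h5 := RDfun_le hP0 hP1 hc h4
    have h6 := mutInfo_convex hP0 hWch hW ht ht1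
    simp only [zero_mul, add_zero]
    rw [hWopt] at h6
    linarith)
  linarith

end KKT

/-- Partition function. -/
def Zf {𝒳 Xh : Type*} [Fintype Xh] (d : 𝒳 → Xh → ℝ) (Q : Xh → ℝ) (lam : ℝ) (x : 𝒳) : ℝ :=
  ∑ y, Q y * Real.exp (-(lam * d x y))

section KKT2
variable {𝒳 Xh : Type*} [Fintype 𝒳] [Fintype Xh]

lemma Zf_pos {𝒳 : Type*} {d : 𝒳 → Xh → ℝ} {Q : Xh → ℝ} (hQ0 : ∀ y, 0 ≤ Q y) (hQ1 : ∑ y, Q y = 1)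
    (lam : ℝ) (x : 𝒳) : 0 < Zf d Q lam x := by
  have h0 : ∀ y ∈ Finset.univ, 0 ≤ Q y * Real.exp (-(lam * d x y)) := fun y _ =>
    mul_nonneg (hQ0 y) (Real.exp_pos _).le
  refine lt_of_le_of_ne (Finset.sum_nonneg h0) fun h => ?_
  have := (Finset.sum_eq_zero_iff_of_nonneg h0).1 h.symm
  have h2 : ∑ y, Q y = 0 := Finset.sum_eq_zero fun y hy => by
    rcases mul_eq_zero.1 (this y hy) with h | h
    · exact h
    · exact absurd h (Real.exp_pos _).ne'
  linarith

lemma dtilted_eq {𝒳 : Type*} {d : 𝒳 → Xh → ℝ} {Q : Xh → ℝ} (hQ0 : ∀ y, 0 ≤ Q y) (hQ1 : ∑ y, Q y = 1)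
    (D lam : ℝ) (x : 𝒳) : dtilted d D Q lam x = -(lam * D) - Real.log (Zf d Q lam x) := by
  have : ∑ y, Q y * Real.exp (lam * D - lam * d x y) = Real.exp (lam * D) * Zf d Q lam x := by
    unfold Zf
    rw [Finset.mul_sum]
    refine Finset.sum_congr rfl fun y _ => ?_
    rw [sub_eq_add_neg, Real.exp_add]; ring
  unfold dtilted
  rw [this, Real.log_mul (Real.exp_pos _).ne' (Zf_pos hQ0 hQ1 lam x).ne', Real.log_exp]; ring

lemma G_ge {P : 𝒳 → ℝ} (hP0 : ∀ x, 0 ≤ P x) (hP1 : ∑ x, P x = 1) {d : 𝒳 → Xh → ℝ} {D : ℝ}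
    {Wopt : 𝒳 → Xh → ℝ} (hWch : IsChannel Wopt)
    (hWd : (∑ x, ∑ y, P x * Wopt x y * d x y) ≤ D)
    (hWopt : mutInfo P Wopt = RDfun P d D)
    {lam : ℝ} (hlam : HasDerivAt (fun D' => RDfun P d D') (-lam) D)
    {Q : Xh → ℝ} (hQ0 : ∀ y, 0 ≤ Q y) (hQ1 : ∑ y, Q y = 1) :
    RDfun P d D + lam * D ≤ - ∑ x, P x * Real.log (Zf d Q lam x) := by
  have hZ := Zf_pos (d := d) hQ0 hQ1 lam
  set W : 𝒳 → Xh → ℝ := fun x y => Q y * Real.exp (-(lam * d x y)) / Zf d Q lam x with hWdef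
  have hW : IsChannel W := by
    intro x
    refine ⟨fun y => div_nonneg (mul_nonneg (hQ0 y) (Real.exp_pos _).le) (hZ x).le, ?_⟩
    rw [hWdef]; simp only
    rw [← Finset.sum_div]
    exact div_self (hZ x).ne'
  have h1 := RD_tangent hP0 hP1 hWch hWd hWopt hlam hW
  have h2 := mutInfo_le_div hP0 hP1 hW hQ0 hQ1 (fun x y h => by simp [hWdef, h])
  have h3 : ∑ x, ∑ y, P x * W x y * Real.log (W x y / Q y) + lam * ∑ x, ∑ y, P x * W x y * d x y
      = - ∑ x, P x * Real.log (Zf d Q lam x) := by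
    rw [Finset.mul_sum, ← Finset.sum_add_distrib, ← Finset.sum_neg_distrib]
    refine Finset.sum_congr rfl fun x _ => ?_
    rw [Finset.mul_sum, ← Finset.sum_add_distrib]
    have : ∀ y, P x * W x y * Real.log (W x y / Q y) + lam * (P x * W x y * d x y) =
      W x y * -(P x * Real.log (Zf d Q lam x)) := by
      intro y
      by_cases hq : Q y = 0
      · simp [hWdef, hq]
      have : W x y / Q y = Real.exp (-(lam * d x y)) / Zf d Q lam x := by
        simp only [hWdef]; field_simp
      rw [this, Real.log_div (Real.exp_pos _).ne' (hZ x).ne', Real.log_exp]; ring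
    rw [Finset.sum_congr rfl fun y _ => this y, ← Finset.sum_mul, (hW x).2, one_mul]
  linarith

/-- KKT conditions. -/
lemma kkt {P : 𝒳 → ℝ} (hP0 : ∀ x, 0 ≤ P x) (hP1 : ∑ x, P x = 1) {d : 𝒳 → Xh → ℝ} {D : ℝ}
    {Wopt : 𝒳 → Xh → ℝ} (hWch : IsChannel Wopt)
    (hWd : (∑ x, ∑ y, P x * Wopt x y * d x y) ≤ D)
    (hWopt : mutInfo P Wopt = RDfun P d D)
    {lam : ℝ} (hlam : HasDerivAt (fun D' => RDfun P d D') (-lam) D) (hlam0 : 0 < lam)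
    {Q : Xh → ℝ} (hQ : Q = outMarg P Wopt) :
    (- ∑ x, P x * Real.log (Zf d Q lam x) = RDfun P d D + lam * D) ∧
    (∀ x, 0 < P x → ∀ y, Wopt x y = Q y * Real.exp (-(lam * d x y)) / Zf d Q lam x) ∧
    (∑ x, ∑ y, P x * Wopt x y * d x y = D) ∧
    (∀ y, ∑ x, P x * (Real.exp (-(lam * d x y)) / Zf d Q lam x) ≤ 1) := by
  have hQ0 : ∀ y, 0 ≤ Q y := fun y => by rw [hQ]; exact outMarg_nonneg hP0 hWch y
  have hQ1 : ∑ y, Q y = 1 := by rw [hQ]; exact outMarg_sum hP1 hWch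
  have hZ := Zf_pos (d := d) hQ0 hQ1 lam
  have hG := G_ge hP0 hP1 hWch hWd hWopt hlam hQ0 hQ1
  set W : 𝒳 → Xh → ℝ := fun x y => Q y * Real.exp (-(lam * d x y)) / Zf d Q lam x with hWdef
  have hW : ∀ x, ∑ y, W x y = 1 := by
    intro x
    rw [hWdef]; simp only
    rw [← Finset.sum_div]
    exact div_self (hZ x).ne'
  have hW0 : ∀ x y, 0 ≤ W x y := fun x y => 
    div_nonneg (mul_nonneg (hQ0 y) (Real.exp_pos _).le) (hZ x).le
  have hWz : ∀ x y, W x y = 0 → Q y = 0 := by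
    intro x y h
    by_contra hq
    have : 0 < Q y := lt_of_le_of_ne (hQ0 y) (Ne.symm hq)
    have := hZ x
    have : 0 < W x y := by simp only [hWdef]; positivity
    exact this.ne' h
  have hQz : ∀ x y, 0 < P x → Q y = 0 → Wopt x y = 0 := by
    intro x y hx h
    rw [hQ] at h
    rcases mul_eq_zero.1 (outMarg_zero hP0 hWch (x := x) h) with h | h
    · exact absurd h hx.ne'
    · exact h
  -- the nonnegative terms
  set T : 𝒳 → Xh → ℝ := fun x y => P x * (Wopt x y * Real.log (Wopt x y / W x y) - Wopt x y + W x y)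
    with hT
  have hT0 : ∀ x y, 0 ≤ T x y := by
    intro x y
    rcases (hP0 x).eq_or_lt with hx | hx
    · simp [hT, ← hx]
    · have := gibbs ((hWch x).1 y) (hW0 x y) (fun h => hQz x y hx (hWz x y h))
      exact mul_nonneg hx.le (by linarith)
  have hTsum : ∑ x, ∑ y, T x y = mutInfo P Wopt + lam * (∑ x, ∑ y, P x * Wopt x y * d x y)
      + ∑ x, P x * Real.log (Zf d Q lam x) := by
    rw [mutInfo_eq, ← hQ, Finset.mul_sum, ← Finset.sum_add_distrib, ← Finset.sum_add_distrib]
    refine Finset.sum_congr rfl fun x _ => ?_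
    have e1 : P x * Real.log (Zf d Q lam x) = ∑ y, (Wopt x y * (P x * Real.log (Zf d Q lam x))
        + P x * (W x y - Wopt x y)) := by
      rw [Finset.sum_add_distrib, ← Finset.sum_mul, ← Finset.mul_sum, Finset.sum_sub_distrib,
        hW, (hWch x).2]; ring
    rw [e1, Finset.mul_sum, ← Finset.sum_add_distrib, ← Finset.sum_add_distrib]
    refine Finset.sum_congr rfl fun y _ => ?_
    simp only [hT]
    by_cases hx : P x * Wopt x y = 0
    · rcases mul_eq_zero.1 hx with h | h <;> simp [h]
    · have hw : Wopt x y ≠ 0 := right_ne_zero_of_mul hx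
      have hpx : 0 < P x := lt_of_le_of_ne (hP0 x) (Ne.symm (left_ne_zero_of_mul hx))
      have hq : Q y ≠ 0 := fun h => hw (hQz x y hpx h)
      have hww : W x y ≠ 0 := fun h => hq (hWz x y h)
      rw [Real.log_div hw hww, Real.log_div hw hq]
      have : Real.log (W x y) = Real.log (Q y) - lam * d x y - Real.log (Zf d Q lam x) := by
        simp only [hWdef]
        rw [Real.log_div (mul_ne_zero hq (Real.exp_pos _).ne') (hZ x).ne',
          Real.log_mul hq (Real.exp_pos _).ne', Real.log_exp]; ring
      rw [this]; ring
  have hTn : 0 ≤ ∑ x, ∑ y, T x y := Finset.sum_nonneg fun x _ => Finset.sum_nonneg fun y _ => hT0 x y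
  have hle := mul_le_mul_of_nonneg_left hWd hlam0.le
  have hT00 : ∑ x, ∑ y, T x y = 0 := by linarith
  have hGeq : - ∑ x, P x * Real.log (Zf d Q lam x) = RDfun P d D + lam * D := by linarith
  refine ⟨hGeq, ?_, ?_, ?_⟩
  · intro x hx y
    have h1 := (Finset.sum_eq_zero_iff_of_nonneg
      (fun x _ => Finset.sum_nonneg fun y _ => hT0 x y)).1 hT00 x (Finset.mem_univ _)
    have h2 := (Finset.sum_eq_zero_iff_of_nonneg (fun y _ => hT0 x y)).1 h1 y (Finset.mem_univ _)
    rcases mul_eq_zero.1 h2 with h | h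
    · exact absurd h hx.ne'
    change Wopt x y = W x y
    rcases (hW0 x y).eq_or_lt with hw | hw
    · rw [← hw, hQz x y hx (hWz x y hw.symm)]
    · exact gibbs_eq ((hWch x).1 y) hw (by linarith)
  · have : lam * (∑ x, ∑ y, P x * Wopt x y * d x y) = lam * D := by linarith
    exact mul_left_cancel₀ hlam0.ne' this
  · intro y
    classical
    set r : 𝒳 → ℝ := fun x => Real.exp (-(lam * d x y)) / Zf d Q lam x with hr
    have hd : HasDerivAt (fun t : ℝ => ∑ x, P x * Real.log (1 + t * (r x - 1)))
        (∑ x, P x * (r x - 1)) 0 := by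
      refine HasDerivAt.fun_sum fun x _ => ?_
      refine HasDerivAt.const_mul _ ?_
      have := (((hasDerivAt_id (0:ℝ)).mul_const (r x - 1)).const_add 1).log (by simp)
      simpa using this
    have h := slope_le (L := 0) hd (fun t ht ht1 => by
      have hQt0 : ∀ y', 0 ≤ (1 - t) * Q y' + t * (if y' = y then 1 else 0) := by
        intro y'
        have := hQ0 y'
        have : 0 < 1 - t := by linarith
        positivity
      have hQt1 : ∑ y', ((1 - t) * Q y' + t * (if y' = y then 1 else 0)) = 1 := by
        rw [Finset.sum_add_distrib, ← Finset.mul_sum, ← Finset.mul_sum, hQ1]; simp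
      have hG' := G_ge hP0 hP1 hWch hWd hWopt hlam hQt0 hQt1
      have hz : ∀ x, Real.log (Zf d (fun y' => (1 - t) * Q y' + t * (if y' = y then 1 else 0)) lam x)
          = Real.log (Zf d Q lam x) + Real.log (1 + t * (r x - 1)) := by
        intro x
        have hrx : 0 < r x := div_pos (Real.exp_pos _) (hZ x)
        rw [← Real.log_mul (hZ x).ne' (by nlinarith)]
        congr 1
        have e : Zf d (fun y' => (1 - t) * Q y' + t * (if y' = y then 1 else 0)) lam x =
          (1 - t) * Zf d Q lam x + t * Real.exp (-(lam * d x y)) := by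
          simp [Zf, add_mul, Finset.sum_add_distrib, Finset.mul_sum, mul_assoc]
        rw [e]
        have : Real.exp (-(lam * d x y)) = r x * Zf d Q lam x := by
          simp only [hr]; rw [div_mul_cancel₀ _ (hZ x).ne']
        rw [this]; ring
      simp only [hz, mul_add, Finset.sum_add_distrib] at hG'
      simp
      linarith)
    rw [← sub_nonpos]
    have e : ∑ x, P x * (r x - 1) = ∑ x, P x * r x - 1 := by
      simp [mul_sub, Finset.sum_sub_distrib, hP1]
    linarith

end KKT2

lemma conv_bound {𝒳 Xh : Type*} [Fintype 𝒳] [Fintype Xh]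
    {P : 𝒳 → ℝ} (hP0 : ∀ x, 0 ≤ P x) {d : 𝒳 → Xh → ℝ} {D lam : ℝ} (hlam : 0 ≤ lam)
    (j : 𝒳 → ℝ) (hk : ∀ y, ∑ x, P x * Real.exp (j x + lam * D - lam * d x y) ≤ 1)
    {n : ℕ} (hn : 0 < n) {M : ℕ} (hM : 0 < M) (f : (Fin n → 𝒳) → Fin M)
    (φ : Fin M → (Fin n → Xh)) (γ : ℝ) :
    Pr (iidP P n) {xs | γ + Real.log M ≤ ∑ i, j (xs i)} ≤
      Pr (iidP P n) {xs | D < distn d xs (φ (f xs))} + Real.exp (-γ) := by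
  have h0 := iidP_nonneg hP0 n
  have hsub : {xs | γ + Real.log M ≤ ∑ i, j (xs i)} ⊆ {xs | D < distn d xs (φ (f xs))} ∪
      {xs | γ + Real.log M ≤ ∑ i, j (xs i) ∧ distn d xs (φ (f xs)) ≤ D} := by
    intro xs hx
    by_cases h : D < distn d xs (φ (f xs))
    · left; exact h
    · right; exact ⟨hx, not_lt.1 h⟩
  refine (Pr_mono h0 hsub).trans ((Pr_union_le h0 _ _).trans ?_)
  gcongr
  have hMr : (0:ℝ) < M := by exact_mod_cast hM
  have hnr : (0:ℝ) < n := by exact_mod_cast hn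
  refine (Pr_le_sum h0 _ (fun xs => ∑ m : Fin M, Real.exp (-γ) / M *
    ∏ i, Real.exp (j (xs i) + lam * D - lam * d (xs i) (φ m i))) ?_ ?_).trans ?_
  · intro xs; positivity
  · rintro xs ⟨h1, h2⟩
    refine le_trans ?_ (Finset.single_le_sum (fun m _ => by positivity) (Finset.mem_univ (f xs)))
    rw [← Real.exp_sum]
    have e : Real.exp (-γ) / M = Real.exp (-γ - Real.log M) := by
      rw [Real.exp_sub, Real.exp_log hMr]
    rw [e, ← Real.exp_add]
    apply Real.one_le_exp
    have e2 : ∑ i, (j (xs i) + lam * D - lam * d (xs i) (φ (f xs) i)) =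
      ∑ i, j (xs i) + lam * (n * D - ∑ i, d (xs i) (φ (f xs) i)) := by
      simp [Finset.sum_sub_distrib, Finset.sum_add_distrib, ← Finset.mul_sum]; ring
    rw [e2]
    unfold distn at h2
    rw [div_le_iff₀ hnr] at h2
    have := mul_nonneg hlam (sub_nonneg.2 h2)
    nlinarith
  · simp only [Finset.mul_sum]
    rw [Finset.sum_comm]
    have : ∀ m : Fin M, ∑ xs, iidP P n xs * (Real.exp (-γ) / M *
        ∏ i, Real.exp (j (xs i) + lam * D - lam * d (xs i) (φ m i))) ≤ Real.exp (-γ) / M := by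
      intro m
      have h := prodW_mul_prod (fun _ : Fin n => P)
        (fun i x => Real.exp (j x + lam * D - lam * d x (φ m i)))
      rw [← iidP_eq_prodW] at h
      have h2 : ∏ i : Fin n, ∑ x, P x * Real.exp (j x + lam * D - lam * d x (φ m i)) ≤ 1 :=
        Finset.prod_le_one (fun i _ => Finset.sum_nonneg fun x _ =>
          mul_nonneg (hP0 x) (Real.exp_pos _).le) (fun i _ => hk _)
      calc _ = Real.exp (-γ) / M * ∑ xs, iidP P n xs *
            ∏ i, Real.exp (j (xs i) + lam * D - lam * d (xs i) (φ m i)) := by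
            rw [Finset.mul_sum]; exact Finset.sum_congr rfl fun xs _ => by ring
        _ ≤ Real.exp (-γ) / M * 1 := by
            rw [h]; gcongr
        _ = _ := mul_one _
    refine (Finset.sum_le_sum fun m _ => this m).trans ?_
    simp
    rw [mul_div_cancel₀ _ hMr.ne']

/-- Hybrid of two strings: first `k` coordinates from the second. -/
def hyb {α : Type*} {n : ℕ} (k : ℕ) (y y' : Fin n → α) : Fin n → α :=
  fun i => if (i : ℕ) < k then y' i else y i

def hybEquiv (α : Type*) (n k : ℕ) : ((Fin n → α) × (Fin n → α)) ≃ ((Fin n → α) × (Fin n → α)) where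
  toFun q := (hyb k q.1 q.2, hyb k q.2 q.1)
  invFun q := (hyb k q.1 q.2, hyb k q.2 q.1)
  left_inv q := by
    ext i <;> simp only [hyb] <;> split_ifs <;> rfl
  right_inv q := by
    ext i <;> simp only [hyb] <;> split_ifs <;> rfl

lemma hyb_prob {α : Type*} [Fintype α] {n : ℕ} {w : Fin n → α → ℝ}
    (h1 : ∀ i, ∑ a, w i a = 1) (k : ℕ) (A : Set (Fin n → α)) :
    ∑ q : (Fin n → α) × (Fin n → α), prodW w q.1 * prodW w q.2 *
      A.indicator (fun _ => (1:ℝ)) (hyb k q.1 q.2) = Pr (prodW w) A := by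
  have e := Equiv.sum_comp (hybEquiv α n k) (fun q => prodW w q.1 * prodW w q.2 *
      A.indicator (fun _ => (1:ℝ)) q.1)
  have e2 : ∀ q : (Fin n → α) × (Fin n → α),
      prodW w (hybEquiv α n k q).1 * prodW w (hybEquiv α n k q).2 = prodW w q.1 * prodW w q.2 := by
    intro q
    simp only [prodW, ← Finset.prod_mul_distrib, hybEquiv, Equiv.coe_fn_mk, hyb]
    refine Finset.prod_congr rfl fun i _ => ?_
    split_ifs <;> ring
  simp only [e2] at e
  change ∑ q : (Fin n → α) × (Fin n → α), prodW w q.1 * prodW w q.2 *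
      A.indicator (fun _ => (1:ℝ)) (hyb k q.1 q.2) = _ at e
  rw [e, Fintype.sum_prod_type]
  unfold Pr
  refine Finset.sum_congr rfl fun y _ => ?_
  simp only
  rw [← Finset.sum_mul, ← Finset.mul_sum, prodW_sum_one h1]
  by_cases hy : y ∈ A <;> simp [hy]

lemma hyb_window {α : Type*} [Fintype α] {n : ℕ} {w : Fin n → α → ℝ}
    (h0 : ∀ i a, 0 ≤ w i a) (h1 : ∀ i, ∑ a, w i a = 1) (f : Fin n → α → ℝ) (B : ℝ)
    (hf0 : ∀ i a, 0 ≤ f i a) (hfB : ∀ i a, f i a ≤ B) (T : ℝ) :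
    Pr (prodW w) {y | T < ∑ i, f i (y i)} * Pr (prodW w) {y | ∑ i, f i (y i) ≤ T} ≤
      n * Pr (prodW w) {y | T - B ≤ ∑ i, f i (y i) ∧ ∑ i, f i (y i) ≤ T} := by
  set Wd := {y : Fin n → α | T - B ≤ ∑ i, f i (y i) ∧ ∑ i, f i (y i) ≤ T} with hWd
  have hl : Pr (prodW w) {y | T < ∑ i, f i (y i)} * Pr (prodW w) {y | ∑ i, f i (y i) ≤ T} =
      ∑ q : (Fin n → α) × (Fin n → α), prodW w q.1 * prodW w q.2 *
      ({y : Fin n → α | T < ∑ i, f i (y i)}.indicator (fun _ => (1:ℝ)) q.1 *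
       {y : Fin n → α | ∑ i, f i (y i) ≤ T}.indicator (fun _ => (1:ℝ)) q.2) := by
    unfold Pr
    rw [Fintype.sum_prod_type, Finset.sum_mul_sum]
    refine Finset.sum_congr rfl fun y _ => Finset.sum_congr rfl fun y' _ => ?_
    by_cases h : T < ∑ i, f i (y i) <;> by_cases h' : ∑ i, f i (y' i) ≤ T <;>
      simp [Set.indicator, h, h']
  have hr : (n:ℝ) * Pr (prodW w) Wd = ∑ k ∈ Finset.range n, ∑ q : (Fin n → α) × (Fin n → α),
      prodW w q.1 * prodW w q.2 * Wd.indicator (fun _ => (1:ℝ)) (hyb (k+1) q.1 q.2) := by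
    simp [hyb_prob h1]
  rw [hl, hr, Finset.sum_comm]
  refine Finset.sum_le_sum fun q _ => ?_
  rw [← Finset.mul_sum]
  refine mul_le_mul_of_nonneg_left ?_ (mul_nonneg (prodW_nonneg h0 _) (prodW_nonneg h0 _))
  have hnn : 0 ≤ ∑ k ∈ Finset.range n, Wd.indicator (fun _ => (1:ℝ)) (hyb (k+1) q.1 q.2) :=
    Finset.sum_nonneg fun k _ => Set.indicator_nonneg (fun _ _ => zero_le_one) _
  by_cases hA : T < ∑ i, f i (q.1 i)
  swap
  · simpa [Set.indicator, hA] using hnn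
  by_cases hB : ∑ i, f i (q.2 i) ≤ T
  swap
  · simpa [Set.indicator, hB] using hnn
  -- find crossing
  have hz : hyb 0 q.1 q.2 = q.1 := by ext i; simp [hyb]
  have hn : hyb n q.1 q.2 = q.2 := by ext i; simp [hyb]
  have hex : ∃ k, ∑ i, f i (hyb k q.1 q.2 i) ≤ T := ⟨n, by rw [hn]; exact hB⟩
  classical
  set k := Nat.find hex with hk
  have hks := Nat.find_spec hex
  have hkn : k ≤ n := Nat.find_min' hex (by rw [hn]; exact hB)
  have hk0 : k ≠ 0 := by
    intro h
    rw [← hk, h, hz] at hks; linarith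
  obtain ⟨l, hl'⟩ := Nat.exists_eq_succ_of_ne_zero hk0
  have hlt : T < ∑ i, f i (hyb l q.1 q.2 i) := by
    have := Nat.find_min hex (m := l) (by omega)
    exact not_le.1 this
  rw [← hk, hl'] at hks
  have hln : l < n := by omega
  have hmem : hyb (l+1) q.1 q.2 ∈ Wd := by
    refine ⟨?_, hks⟩
    have hdiff : ∑ i, f i (hyb l q.1 q.2 i) ≤ ∑ i, f i (hyb (l+1) q.1 q.2 i) + B := by
      have : ∑ i : Fin n, (if i = ⟨l, hln⟩ then B else 0) = B := by simp
      rw [← this, ← Finset.sum_add_distrib]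
      refine Finset.sum_le_sum fun i _ => ?_
      by_cases hi : i = ⟨l, hln⟩
      · rw [if_pos hi]
        have := hfB i (hyb l q.1 q.2 i)
        have := hf0 i (hyb (l+1) q.1 q.2 i)
        linarith
      · have : hyb l q.1 q.2 i = hyb (l+1) q.1 q.2 i := by
          have : (i:ℕ) ≠ l := fun h => hi (Fin.ext h)
          have h2 : ((i:ℕ) < l + 1) ↔ ((i:ℕ) < l) := by omega
          simp [hyb, h2]
        rw [if_neg hi, this, add_zero]
    linarith
  calc _ = (1:ℝ) := by simp [Set.indicator, hA, hB]
    _ = Wd.indicator (fun _ => (1:ℝ)) (hyb (l+1) q.1 q.2) := by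
        rw [Set.indicator_of_mem hmem]
    _ ≤ _ := Finset.single_le_sum (f := fun k => Wd.indicator (fun _ => (1:ℝ)) (hyb (k+1) q.1 q.2))
        (fun k _ => Set.indicator_nonneg (fun _ _ => zero_le_one) _) (Finset.mem_range.2 hln)

lemma tail_lb {Ω : Type*} [Fintype Ω] {μ : Ω → ℝ} (h0 : ∀ x, 0 ≤ μ x) (U : Ω → ℝ) (L : ℝ)
    (hU : ∀ x, |U x| ≤ L) (hm : ∑ x, μ x * U x = 0) :
    ∑ x, μ x * U x ^ 2 ≤ 2 * L ^ 2 * Pr μ {x | 0 < U x} := by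
  have : ∑ x, μ x * U x ^ 2 = ∑ x, μ x * (U x ^ 2 + L * U x) := by
    have : ∑ x, μ x * (U x ^ 2 + L * U x) = ∑ x, μ x * U x ^ 2 + L * ∑ x, μ x * U x := by
      rw [Finset.mul_sum, ← Finset.sum_add_distrib]
      exact Finset.sum_congr rfl fun x _ => by ring
    rw [this, hm]; ring
  rw [this]
  unfold Pr
  rw [Finset.mul_sum]
  refine Finset.sum_le_sum fun x _ => ?_
  obtain ⟨h1, h2⟩ := abs_le.1 (hU x)
  by_cases h : 0 < U x
  · rw [Set.indicator_of_mem (by exact h)]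
    have : U x ^ 2 + L * U x ≤ 2 * L ^ 2 := by nlinarith
    nlinarith [h0 x]
  · rw [Set.indicator_of_notMem (by exact h)]
    have : U x ^ 2 + L * U x ≤ 0 := by nlinarith [not_lt.1 h]
    nlinarith [h0 x]

lemma window_lb {α : Type*} [Fintype α] {n : ℕ} (hn : 0 < n) {w : Fin n → α → ℝ}
    (h0 : ∀ i a, 0 ≤ w i a) (h1 : ∀ i, ∑ a, w i a = 1) (f : Fin n → α → ℝ) (B : ℝ) (hB : 0 < B)
    (hf0 : ∀ i a, 0 ≤ f i a) (hfB : ∀ i a, f i a ≤ B) (m : Fin n → ℝ)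
    (hm : ∀ i, ∑ a, w i a * f i a = m i) (c : ℝ) (hc : 0 ≤ c)
    (hvar : c * n ≤ ∑ i, ∑ a, w i a * (f i a - m i) ^ 2) :
    c ^ 2 / (4 * B ^ 4 * n ^ 3) ≤
      Pr (prodW w) {y | ∑ i, m i - B ≤ ∑ i, f i (y i) ∧ ∑ i, f i (y i) ≤ ∑ i, m i} := by
  have hnr : (0:ℝ) < n := by exact_mod_cast hn
  have hp0 := prodW_nonneg h0
  have hmean : ∑ y, prodW w y * (∑ i, (f i (y i) - m i)) = 0 := by
    rw [prodW_mean h1 (fun i a => f i a - m i)]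
    refine Finset.sum_eq_zero fun i _ => ?_
    simp [mul_sub, Finset.sum_sub_distrib, hm, ← Finset.sum_mul, h1]
  have hv := prodW_var h1 (fun i a => f i a - m i) (fun i => by
    simp [mul_sub, Finset.sum_sub_distrib, hm, ← Finset.sum_mul, h1])
  have hm0 : ∀ i, 0 ≤ m i := fun i => by
    rw [← hm]; exact Finset.sum_nonneg fun a _ => mul_nonneg (h0 i a) (hf0 i a)
  have hmB : ∀ i, m i ≤ B := fun i => by
    rw [← hm, ← one_mul B, ← h1 i, Finset.sum_mul]
    exact Finset.sum_le_sum fun a _ => mul_le_mul_of_nonneg_left (hfB i a) (h0 i a)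
  have hL : ∀ y : Fin n → α, |∑ i, (f i (y i) - m i)| ≤ n * B := by
    intro y
    refine (Finset.abs_sum_le_sum_abs _ _).trans ?_
    calc ∑ i : Fin n, |f i (y i) - m i| ≤ ∑ i : Fin n, B := by
          refine Finset.sum_le_sum fun i _ => abs_le.2 ⟨?_, ?_⟩
          · linarith [hf0 i (y i), hmB i]
          · linarith [hfB i (y i), hm0 i]
      _ = n * B := by simp
  have t1 := tail_lb hp0 _ _ hL hmean
  have t2 := tail_lb hp0 (fun y => -∑ i, (f i (y i) - m i)) (n * B)
    (fun y => by rw [abs_neg]; exact hL y) (by simp only [mul_neg, Finset.sum_neg_distrib, hmean, neg_zero])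
  simp only [neg_sq] at t2
  rw [hv] at t1 t2
  have s1 : {y : Fin n → α | 0 < ∑ i, (f i (y i) - m i)} = {y | ∑ i, m i < ∑ i, f i (y i)} := by
    ext y; simp
  have s2 : Pr (prodW w) {y : Fin n → α | 0 < -∑ i, (f i (y i) - m i)} ≤
     Pr (prodW w) {y | ∑ i, f i (y i) ≤ ∑ i, m i} := by
    refine Pr_mono hp0 fun y hy => ?_
    simp at hy ⊢; exact hy.le
  rw [s1] at t1
  have hw := hyb_window h0 h1 f B hf0 hfB (∑ i, m i)
  set a := Pr (prodW w) {y | ∑ i, m i < ∑ i, f i (y i)}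
  set b := Pr (prodW w) {y | ∑ i, f i (y i) ≤ ∑ i, m i}
  set W := Pr (prodW w) {y | ∑ i, m i - B ≤ ∑ i, f i (y i) ∧ ∑ i, f i (y i) ≤ ∑ i, m i}
  have ka : c / (2 * B ^ 2 * n) ≤ a := by
    rw [div_le_iff₀ (by positivity)]
    have : c * n ≤ (a * (2 * B ^ 2 * n)) * n := by nlinarith
    exact le_of_mul_le_mul_right this hnr
  have kb : c / (2 * B ^ 2 * n) ≤ b := by
    rw [div_le_iff₀ (by positivity)]
    have : c * n ≤ (b * (2 * B ^ 2 * n)) * n := by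
      have : 2 * (n * B) ^ 2 * Pr (prodW w) {y : Fin n → α | 0 < -∑ i, (f i (y i) - m i)} ≤ 2 * (n * B) ^ 2 * b :=
        mul_le_mul_of_nonneg_left s2 (by positivity)
      nlinarith
    exact le_of_mul_le_mul_right this hnr
  have hk : 0 ≤ c / (2 * B ^ 2 * n) := by positivity
  have hab := mul_le_mul ka kb hk (hk.trans ka)
  have : c ^ 2 / (4 * B ^ 4 * n ^ 3) * n = c / (2 * B ^ 2 * n) * (c / (2 * B ^ 2 * n)) := by
    field_simp; ring
  have : c ^ 2 / (4 * B ^ 4 * n ^ 3) * n ≤ W * n := by linarith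
  exact le_of_mul_le_mul_right this hnr

/-- Optimal (tilted) channel. -/
def Wst {𝒳 Xh : Type*} [Fintype Xh] (d : 𝒳 → Xh → ℝ) (Q : Xh → ℝ) (lam : ℝ) (x : 𝒳) (y : Xh) : ℝ :=
  Q y * Real.exp (-(lam * d x y)) / Zf d Q lam x

/-- Conditional mean of the distortion. -/
def muf {𝒳 Xh : Type*} [Fintype Xh] (d : 𝒳 → Xh → ℝ) (Q : Xh → ℝ) (lam : ℝ) (x : 𝒳) : ℝ :=
  ∑ y, Wst d Q lam x y * d x y

/-- Conditional variance of the distortion. -/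
def vf {𝒳 Xh : Type*} [Fintype Xh] (d : 𝒳 → Xh → ℝ) (Q : Xh → ℝ) (lam : ℝ) (x : 𝒳) : ℝ :=
  ∑ y, Wst d Q lam x y * (d x y - muf d Q lam x) ^ 2

section ball
variable {𝒳 Xh : Type*} [Fintype Xh] {d : 𝒳 → Xh → ℝ} {Q : Xh → ℝ}

lemma Wst_nonneg (hQ0 : ∀ y, 0 ≤ Q y) (hQ1 : ∑ y, Q y = 1) (lam : ℝ) (x : 𝒳) (y : Xh) :
    0 ≤ Wst d Q lam x y :=
  div_nonneg (mul_nonneg (hQ0 y) (Real.exp_pos _).le) (Zf_pos hQ0 hQ1 lam x).le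

lemma Wst_sum (hQ0 : ∀ y, 0 ≤ Q y) (hQ1 : ∑ y, Q y = 1) (lam : ℝ) (x : 𝒳) :
    ∑ y, Wst d Q lam x y = 1 := by
  unfold Wst
  rw [← Finset.sum_div]
  exact div_self (Zf_pos hQ0 hQ1 lam x).ne'

lemma ball_core (hQ0 : ∀ y, 0 ≤ Q y) (hQ1 : ∑ y, Q y = 1) {lam : ℝ} (hlam : 0 ≤ lam) {B : ℝ}
    (hB : 0 < B) (hd : ∀ x y, 0 ≤ d x y) (hdB : ∀ x y, d x y ≤ B) (D : ℝ) {n : ℕ} (hn : 0 < n)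
    (xs : Fin n → 𝒳) (η E v0 : ℝ) (hv0 : 0 < v0) (hη : |η| * B ≤ 1 / 2)
    (hηv : η * ∑ i, vf d Q lam (xs i) = ∑ i, (muf d Q lam (xs i) - D))
    (hE : η * ∑ i, (muf d Q lam (xs i) - D) ≤ E) (hv : v0 * n ≤ ∑ i, vf d Q lam (xs i)) :
    (v0 / 2) ^ 2 / (4 * B ^ 4 * n ^ 3) *
      Real.exp (-(∑ i, dtilted d D Q lam (xs i) + lam * B + 1 / 2 + E)) ≤
      Pr (iidP Q n) {ys | distn d xs ys ≤ D} := by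
  have hnr : (0:ℝ) < n := by exact_mod_cast hn
  have hW0 := Wst_nonneg (d := d) hQ0 hQ1 lam
  have hW1 := Wst_sum (d := d) hQ0 hQ1 lam
  set μ := muf d Q lam with hμ
  have hμ0 : ∀ x, 0 ≤ μ x := fun x => Finset.sum_nonneg fun y _ => mul_nonneg (hW0 x y) (hd x y)
  have hμB : ∀ x, μ x ≤ B := fun x => by
    rw [← one_mul B, ← hW1 x, Finset.sum_mul]
    exact Finset.sum_le_sum fun a _ => mul_le_mul_of_nonneg_left (hdB x a) (hW0 x a)
  have hab : ∀ x y, |η * (μ x - d x y)| ≤ 1 / 2 := by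
    intro x y
    rw [abs_mul]
    refine le_trans (mul_le_mul_of_nonneg_left ?_ (abs_nonneg _)) hη
    rw [abs_le]
    constructor <;> linarith [hμ0 x, hμB x, hd x y, hdB x y]
  set w : Fin n → Xh → ℝ := fun i y => Wst d Q lam (xs i) y * (1 + η * (μ (xs i) - d (xs i) y))
    with hw
  have hcen : ∀ x, ∑ y, Wst d Q lam x y * (μ x - d x y) = 0 := by
    intro x
    simp only [mul_sub, Finset.sum_sub_distrib, ← Finset.sum_mul, hW1]
    simp [hμ, muf]
  have hw0 : ∀ i y, 0 ≤ w i y := fun i y =>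
    mul_nonneg (hW0 _ _) (by linarith [(abs_le.1 (hab (xs i) y)).1])
  have hw1 : ∀ i, ∑ y, w i y = 1 := by
    intro i
    have : ∑ y, w i y = ∑ y, Wst d Q lam (xs i) y +
      η * ∑ y, Wst d Q lam (xs i) y * (μ (xs i) - d (xs i) y) := by
      rw [Finset.mul_sum, ← Finset.sum_add_distrib]
      exact Finset.sum_congr rfl fun y _ => by simp only [hw]; ring
    rw [this, hcen, hW1]; ring
  have hm : ∀ i, ∑ y, w i y * d (xs i) y = μ (xs i) - η * vf d Q lam (xs i) := by
    intro i
    have : ∑ y, w i y * d (xs i) y = ∑ y, Wst d Q lam (xs i) y * d (xs i) y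
      - η * ∑ y, Wst d Q lam (xs i) y * (d (xs i) y - μ (xs i)) ^ 2
      + η * μ (xs i) * ∑ y, Wst d Q lam (xs i) y * (μ (xs i) - d (xs i) y) := by
      rw [Finset.mul_sum, Finset.mul_sum, ← Finset.sum_sub_distrib, ← Finset.sum_add_distrib]
      exact Finset.sum_congr rfl fun y _ => by simp only [hw]; ring
    rw [this, hcen]
    simp [hμ, muf, vf]
  have hvar : (v0 / 2) * n ≤ ∑ i, ∑ y, w i y * (d (xs i) y - (μ (xs i) - η * vf d Q lam (xs i))) ^ 2 := by
    calc (v0 / 2) * n ≤ ∑ i, vf d Q lam (xs i) / 2 := by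
          rw [← Finset.sum_div]; linarith
      _ ≤ _ := by
          refine Finset.sum_le_sum fun i _ => ?_
          set m := μ (xs i) - η * vf d Q lam (xs i)
          have h1 : vf d Q lam (xs i) ≤ ∑ y, Wst d Q lam (xs i) y * (d (xs i) y - m) ^ 2 := by
            have : ∑ y, Wst d Q lam (xs i) y * (d (xs i) y - m) ^ 2 = vf d Q lam (xs i) 
              - 2 * (μ (xs i) - m) * ∑ y, Wst d Q lam (xs i) y * (μ (xs i) - d (xs i) y)
              + (μ (xs i) - m) ^ 2 * ∑ y, Wst d Q lam (xs i) y := by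
              unfold vf
              rw [Finset.mul_sum, Finset.mul_sum, ← Finset.sum_sub_distrib, ← Finset.sum_add_distrib]
              exact Finset.sum_congr rfl fun y _ => by rw [← hμ]; ring
            rw [this, hcen, hW1]
            nlinarith [sq_nonneg (μ (xs i) - m)]
          refine le_trans (div_le_div_of_nonneg_right h1 (by norm_num)) ?_
          rw [Finset.sum_div]
          refine Finset.sum_le_sum fun y _ => ?_
          have h2 := (abs_le.1 (hab (xs i) y)).1
          have h3 : 0 ≤ Wst d Q lam (xs i) y * (d (xs i) y - m) ^ 2 := mul_nonneg (hW0 _ _) (sq_nonneg _)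
          have : w i y * (d (xs i) y - m) ^ 2 =
            (Wst d Q lam (xs i) y * (d (xs i) y - m) ^ 2) * (1 + η * (μ (xs i) - d (xs i) y)) := by
            simp only [hw]; ring
          rw [this]
          nlinarith
  have key := window_lb hn hw0 hw1 (fun i y => d (xs i) y) B hB (fun i y => hd _ y)
    (fun i y => hdB _ y) _ hm (v0 / 2) (by positivity) hvar
  have hms : ∑ i, (μ (xs i) - η * vf d Q lam (xs i)) = n * D := by
    rw [Finset.sum_sub_distrib, ← Finset.mul_sum, hηv, Finset.sum_sub_distrib]; simp
  rw [hms] at key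
  rw [Real.exp_neg, ← div_eq_mul_inv, div_le_iff₀ (Real.exp_pos _)]
  refine key.trans ?_
  unfold Pr
  rw [Finset.sum_mul]
  refine Finset.sum_le_sum fun ys _ => ?_
  by_cases hy : (n * D - B ≤ ∑ i, d (xs i) (ys i) ∧ ∑ i, d (xs i) (ys i) ≤ n * D)
  swap
  · rw [Set.indicator_of_notMem (by exact hy)]
    exact mul_nonneg (Set.indicator_nonneg (fun y _ => iidP_nonneg hQ0 n y) _) (Real.exp_pos _).le
  rw [Set.indicator_of_mem (by exact hy), Set.indicator_of_mem (by
    change distn d xs ys ≤ D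
    unfold distn
    rw [div_le_iff₀ hnr]; linarith [hy.2])]
  have hwle : ∀ i, w i (ys i) ≤ Q (ys i) * Real.exp (-(lam * d (xs i) (ys i))
      - Real.log (Zf d Q lam (xs i)) + η * (μ (xs i) - d (xs i) (ys i))) := by
    intro i
    have hz := Zf_pos (d := d) hQ0 hQ1 lam (xs i)
    have e : Q (ys i) * Real.exp (-(lam * d (xs i) (ys i))
      - Real.log (Zf d Q lam (xs i)) + η * (μ (xs i) - d (xs i) (ys i))) = 
      Wst d Q lam (xs i) (ys i) * Real.exp (η * (μ (xs i) - d (xs i) (ys i))) := by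
      rw [Real.exp_add, Real.exp_sub, Real.exp_log hz, Wst]; ring
    rw [e]
    refine mul_le_mul_of_nonneg_left ?_ (hW0 _ _)
    linarith [Real.add_one_le_exp (η * (μ (xs i) - d (xs i) (ys i)))]
  calc prodW w ys ≤ ∏ i, (Q (ys i) * Real.exp (-(lam * d (xs i) (ys i))
      - Real.log (Zf d Q lam (xs i)) + η * (μ (xs i) - d (xs i) (ys i)))) :=
        Finset.prod_le_prod (fun i _ => hw0 i _) (fun i _ => hwle i)
    _ = iidP Q n ys * Real.exp (∑ i, (-(lam * d (xs i) (ys i))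
      - Real.log (Zf d Q lam (xs i)) + η * (μ (xs i) - d (xs i) (ys i)))) := by
        rw [Finset.prod_mul_distrib, Real.exp_sum]; rfl
    _ ≤ _ := by
        refine mul_le_mul_of_nonneg_left (Real.exp_le_exp.2 ?_) (iidP_nonneg hQ0 n _)
        simp only [dtilted_eq hQ0 hQ1]
        have e1 : ∑ i, (-(lam * d (xs i) (ys i))
          - Real.log (Zf d Q lam (xs i)) + η * (μ (xs i) - d (xs i) (ys i))) =
          ∑ i, (-(lam * D) - Real.log (Zf d Q lam (xs i)))
          + lam * (n * D - ∑ i, d (xs i) (ys i))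
          + η * ∑ i, (μ (xs i) - D) + η * (n * D - ∑ i, d (xs i) (ys i)) := by
          have e2 : (n:ℝ) * D = ∑ i : Fin n, D := by simp
          rw [e2, ← Finset.sum_sub_distrib]
          simp only [Finset.mul_sum, ← Finset.sum_add_distrib]
          exact Finset.sum_congr rfl fun i _ => by ring
        rw [e1]
        have h1 : lam * (n * D - ∑ i, d (xs i) (ys i)) ≤ lam * B :=
          mul_le_mul_of_nonneg_left (by linarith [hy.1]) hlam
        have h2 : η * (n * D - ∑ i, d (xs i) (ys i)) ≤ 1 / 2 := by
          refine le_trans (le_abs_self _) ?_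
          rw [abs_mul]
          refine le_trans (mul_le_mul_of_nonneg_left ?_ (abs_nonneg _)) hη
          rw [abs_le]; constructor <;> linarith [hy.1, hy.2]
        linarith
end ball

lemma ev_log (a b : ℝ) : ∃ n₀ : ℕ, ∀ n ≥ n₀, a ≤ Real.log n ∧ b * Real.log n ≤ n := by
  have h1 : Filter.Tendsto (fun n : ℕ => Real.log n) Filter.atTop Filter.atTop :=
    Real.tendsto_log_atTop.comp tendsto_natCast_atTop_atTop
  have h2 := (Real.isLittleO_log_id_atTop.comp_tendsto tendsto_natCast_atTop_atTop).bound
    (show (0:ℝ) < 1 / (|b| + 1) by positivity)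
  obtain ⟨n₀, h⟩ := Filter.eventually_atTop.1 ((h1.eventually_ge_atTop a).and h2)
  refine ⟨n₀, fun n hn => ⟨(h n hn).1, ?_⟩⟩
  have h3 := (h n hn).2
  simp only [Function.comp, id, Real.norm_eq_abs, Nat.abs_cast] at h3
  calc b * Real.log n ≤ |b| * |Real.log n| := by rw [← abs_mul]; exact le_abs_self _
    _ ≤ (|b| + 1) * |Real.log n| := by gcongr; linarith
    _ ≤ (|b| + 1) * (1 / (|b| + 1) * n) := by gcongr
    _ = n := by field_simp

lemma ball_lb {𝒳 Xh : Type*} [Fintype Xh] {d : 𝒳 → Xh → ℝ} {Q : Xh → ℝ}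
    (hQ0 : ∀ y, 0 ≤ Q y) (hQ1 : ∑ y, Q y = 1) {lam : ℝ} (hlam : 0 ≤ lam) {B : ℝ}
    (hB : 0 < B) (hd : ∀ x y, 0 ≤ d x y) (hdB : ∀ x y, d x y ≤ B) (D K v0 : ℝ) (hK : 0 < K)
    (hv0 : 0 < v0) :
    ∃ C > 0, ∃ n₀ : ℕ, ∀ n ≥ n₀, ∀ xs : Fin n → 𝒳,
      |∑ i, (muf d Q lam (xs i) - D)| ≤ K * Real.sqrt (n * Real.log n) →
      v0 * n ≤ ∑ i, vf d Q lam (xs i) →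
      Real.exp (-(∑ i, dtilted d D Q lam (xs i) + C * Real.log n)) ≤
        Pr (iidP Q n) {ys | distn d xs ys ≤ D} := by
  set c0 := (v0 / 2) ^ 2 / (4 * B ^ 4) with hc0
  have hc0p : 0 < c0 := by positivity
  obtain ⟨n₁, h₁⟩ := ev_log (max 1 (lam * B + 1 / 2 - Real.log c0)) (4 * K ^ 2 * B ^ 2 / v0 ^ 2)
  refine ⟨K ^ 2 / v0 + 4, by positivity, max n₁ 1, fun n hn xs h1 h2 => ?_⟩
  have hn0 : 0 < n := lt_of_lt_of_le one_pos (le_trans (le_max_right _ _) hn)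
  have hnr : (0:ℝ) < n := by exact_mod_cast hn0
  obtain ⟨ha, hb⟩ := h₁ n (le_trans (le_max_left _ _) hn)
  have hl1 : 1 ≤ Real.log n := le_trans (le_max_left _ _) ha
  have hl2 := le_trans (le_max_right _ _) ha
  set l := Real.log n with hl
  set Sv := ∑ i, vf d Q lam (xs i) with hSv
  set Sm := ∑ i, (muf d Q lam (xs i) - D) with hSm
  have hSvp : 0 < Sv := lt_of_lt_of_le (by positivity) h2
  have hsq : Sm ^ 2 ≤ K ^ 2 * (n * l) := by
    have := pow_le_pow_left₀ (abs_nonneg _) h1 2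
    rwa [sq_abs, mul_pow, Real.sq_sqrt (by positivity)] at this
  have hη : |Sm / Sv| * B ≤ 1 / 2 := by
    rw [abs_div, abs_of_pos hSvp, div_mul_eq_mul_div, div_le_iff₀ hSvp]
    have h3 : (|Sm| * B) ^ 2 ≤ (1 / 2 * (v0 * n)) ^ 2 := by
      rw [mul_pow, sq_abs]
      have : 4 * K ^ 2 * B ^ 2 * l ≤ n * v0 ^ 2 := by
        rw [div_mul_eq_mul_div, div_le_iff₀ (by positivity)] at hb; exact hb
      calc Sm ^ 2 * B ^ 2 ≤ K ^ 2 * (n * l) * B ^ 2 := by gcongr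
        _ = (4 * K ^ 2 * B ^ 2 * l) * (n / 4) := by ring
        _ ≤ (n * v0 ^ 2) * (n / 4) := by gcongr
        _ = _ := by ring
    have := abs_le_of_sq_le_sq h3 (by positivity)
    have := (abs_le.1 this).2
    linarith
  have key := ball_core hQ0 hQ1 hlam hB hd hdB D hn0 xs (Sm / Sv) (K ^ 2 / v0 * l) v0 hv0 hη
    (by rw [div_mul_cancel₀ _ hSvp.ne']) (by
      rw [← hSm, div_mul_eq_mul_div, div_le_iff₀ hSvp]
      calc Sm * Sm = Sm ^ 2 := by ring
        _ ≤ K ^ 2 * (n * l) := hsq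
        _ = K ^ 2 / v0 * l * (v0 * n) := by field_simp
        _ ≤ _ := by gcongr) h2
  refine le_trans ?_ key
  have e : (v0 / 2) ^ 2 / (4 * B ^ 4 * n ^ 3) = Real.exp (Real.log c0 - 3 * l) := by
    rw [Real.exp_sub, Real.exp_log hc0p]
    have : Real.exp (3 * l) = (n:ℝ) ^ 3 := by
      rw [mul_comm, hl, Real.exp_mul, Real.exp_log hnr]; norm_cast
    rw [this, hc0]; field_simp
  rw [e, ← Real.exp_add]
  apply Real.exp_le_exp.2
  linarith

lemma cover {Ω Y : Type*} [Fintype Ω] [Fintype Y] {μ : Ω → ℝ} (hμ0 : ∀ x, 0 ≤ μ x)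
    (hμ1 : ∑ x, μ x = 1) {ν : Y → ℝ} (hν0 : ∀ y, 0 ≤ ν y) (hν1 : ∑ y, ν y = 1)
    (R : Ω → Y → Prop) (G : Set Ω) (p : ℝ) (hG : ∀ x ∈ G, p ≤ Pr ν {y | R x y})
    {M : ℕ} (hM : 0 < M) :
    ∃ (f : Ω → Fin M) (φ : Fin M → Y), Pr μ {x | x ∈ G ∧ ¬ R x (φ (f x))} ≤ Real.exp (-(p * M)) := by
  classical
  have hex : ∃ φ : Fin M → Y, Pr μ {x | x ∈ G ∧ ∀ m, ¬ R x (φ m)} ≤ Real.exp (-(p * M)) := by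
    by_contra hcon
    push Not at hcon
    have h1 : Real.exp (-(p * M)) <
        ∑ φ, iidP ν M φ * Pr μ {x | x ∈ G ∧ ∀ m, ¬ R x (φ m)} := by
      calc Real.exp (-(p * M)) = ∑ φ, iidP ν M φ * Real.exp (-(p * M)) := by
            rw [← Finset.sum_mul, iidP_sum_one hν1, one_mul]
        _ < _ := by
            refine Finset.sum_lt_sum (fun φ _ => mul_le_mul_of_nonneg_left (hcon φ).le
              (iidP_nonneg hν0 M φ)) ?_
            by_contra hall
            push Not at hall
            have : ∀ φ : Fin M → Y, iidP ν M φ = 0 := by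
              intro φ
              by_contra hne
              have hpos : 0 < iidP ν M φ := lt_of_le_of_ne (iidP_nonneg hν0 M φ) (Ne.symm hne)
              exact absurd (hall φ (Finset.mem_univ _))
                (not_le.2 (mul_lt_mul_of_pos_left (hcon φ) hpos))
            have h := iidP_sum_one hν1 M
            rw [Finset.sum_eq_zero fun φ _ => this φ] at h
            exact zero_ne_one h
    refine absurd h1 (not_lt.2 ?_)
    unfold Pr
    simp only [Finset.mul_sum]
    rw [Finset.sum_comm]
    calc _ ≤ ∑ x, μ x * Real.exp (-(p * M)) := ?_
      _ = Real.exp (-(p * M)) := by rw [← Finset.sum_mul, hμ1, one_mul]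
    refine Finset.sum_le_sum fun x _ => ?_
    by_cases hx : x ∈ G
    swap
    · simp [Set.indicator, hx]
      exact mul_nonneg (hμ0 x) (Real.exp_pos _).le
    have e : ∀ φ : Fin M → Y, iidP ν M φ * {x | x ∈ G ∧ ∀ m, ¬ R x (φ m)}.indicator μ x =
        μ x * (prodW (fun _ => ν) φ * ∏ m, (if R x (φ m) then (0:ℝ) else 1)) := by
      intro φ
      rw [iidP_eq_prodW]
      by_cases h : ∀ m, ¬ R x (φ m)
      · simp [Set.indicator, hx, h]; ring
      · have : ∏ m, (if R x (φ m) then (0:ℝ) else 1) = 0 := by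
          push Not at h
          obtain ⟨m, hm⟩ := h
          exact Finset.prod_eq_zero (Finset.mem_univ m) (by simp [hm])
        rw [this]
        rw [Set.indicator_of_notMem (by simp only [Set.mem_ofPred_eq, not_and]; exact fun _ => h)]
        simp
    rw [Finset.sum_congr rfl fun φ _ => e φ, ← Finset.mul_sum,
      prodW_mul_prod (fun _ => ν) (fun _ y => if R x y then (0:ℝ) else 1)]
    refine mul_le_mul_of_nonneg_left ?_ (hμ0 x)
    have h2 : ∑ y, ν y * (if R x y then (0:ℝ) else 1) ≤ Real.exp (-p) := by
      have e2 : ∑ y, ν y * (if R x y then (0:ℝ) else 1) = 1 - Pr ν {y | R x y} := by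
        unfold Pr
        rw [← hν1, ← Finset.sum_sub_distrib]
        refine Finset.sum_congr rfl fun y _ => ?_
        by_cases h : R x y <;> simp [Set.indicator, h, hν1]
      rw [e2]
      linarith [hG x hx, Real.add_one_le_exp (-p)]
    have h3 : 0 ≤ ∑ y, ν y * (if R x y then (0:ℝ) else 1) :=
      Finset.sum_nonneg fun y _ => mul_nonneg (hν0 y) (by split_ifs <;> norm_num)
    rw [Finset.prod_const, Finset.card_univ, Fintype.card_fin]
    refine (pow_le_pow_left₀ h3 h2 M).trans ?_
    rw [← Real.exp_nat_mul]
    apply le_of_eq; congr 1; ring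
  obtain ⟨φ, hφ⟩ := hex
  refine ⟨fun x => if h : ∃ m, R x (φ m) then h.choose else ⟨0, hM⟩, φ, ?_⟩
  refine le_trans (Pr_mono hμ0 ?_) hφ
  rintro x ⟨hx, hn⟩
  refine ⟨hx, fun m hm => hn ?_⟩
  have h : ∃ m, R x (φ m) := ⟨m, hm⟩
  beta_reduce
  rw [dif_pos h]
  exact h.choose_spec

lemma ev_sqrt (a b : ℝ) : ∃ n₀ : ℕ, ∀ n ≥ n₀, a ≤ Real.log n ∧ b * Real.log n ≤ Real.sqrt n ∧
    a ≤ Real.sqrt n := by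
  have h2 := ((isLittleO_log_rpow_atTop (show (0:ℝ) < 1 / 2 by norm_num)).comp_tendsto
    tendsto_natCast_atTop_atTop).bound (show (0:ℝ) < 1 / (|b| + 1) by positivity)
  have h3 := Filter.Tendsto.comp Real.tendsto_sqrt_atTop
    (tendsto_natCast_atTop_atTop (R := ℝ))
  obtain ⟨n₁, h1⟩ := ev_log a 0
  obtain ⟨n₀, h⟩ := Filter.eventually_atTop.1 (h2.and (h3.eventually_ge_atTop a))
  refine ⟨max n₀ n₁, fun n hn => ⟨(h1 n (le_trans (le_max_right _ _) hn)).1, ?_,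
    (h n (le_trans (le_max_left _ _) hn)).2⟩⟩
  have h4 := (h n (le_trans (le_max_left _ _) hn)).1
  simp only [Function.comp, ← Real.sqrt_eq_rpow, Real.norm_eq_abs,
    abs_of_nonneg (Real.sqrt_nonneg (n:ℝ))] at h4
  calc b * Real.log n ≤ |b| * |Real.log n| := by rw [← abs_mul]; exact le_abs_self _
    _ ≤ (|b| + 1) * |Real.log n| := by gcongr; linarith
    _ ≤ (|b| + 1) * (1 / (|b| + 1) * Real.sqrt n) := by gcongr
    _ = Real.sqrt n := by field_simp

lemma conv_asymp {𝒳 Xh : Type*} [Fintype 𝒳] [Fintype Xh]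
    {P : 𝒳 → ℝ} (hP0 : ∀ x, 0 ≤ P x) (hP1 : ∑ x, P x = 1) {d : 𝒳 → Xh → ℝ} {D lam : ℝ}
    (hlam : 0 ≤ lam)
    (j : 𝒳 → ℝ) (hk : ∀ y, ∑ x, P x * Real.exp (j x + lam * D - lam * d x y) ≤ 1)
    {R V z ε : ℝ} (hR : ∑ x, P x * j x = R) (hV : V = ∑ x, P x * (j x - R) ^ 2) (hVp : 0 < V)
    (hz : gaussQ z = ε) :
    ∃ C > 0, ∃ n₀ : ℕ, ∀ n ≥ n₀, ∀ M : ℕ, 0 < M → ∀ (f : (Fin n → 𝒳) → Fin M)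
      (φ : Fin M → (Fin n → Xh)), Pr (iidP P n) {xs | D < distn d xs (φ (f xs))} ≤ ε →
      n * R + Real.sqrt (n * V) * z - C * Real.log n ≤ Real.log M := by
  have hcen : ∑ x, P x * (j x - R) = 0 := by
    simp [mul_sub, Finset.sum_sub_distrib, hR, ← Finset.sum_mul, hP1]
  obtain ⟨c, hc, hsl⟩ := gaussQ_slope z
  have hsV : 0 < Real.sqrt V := Real.sqrt_pos.2 hVp
  obtain ⟨Cb, hCb, n₁, hbe⟩ := be_lower P hP0 hP1 (fun x => j x - R) hcen V hV hVp
    (Real.sqrt V * |z| + 1) (by positivity)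
  set c1 := (Cb + 2) * Real.sqrt V / c with hc1
  have hc1p : 0 < c1 := by positivity
  obtain ⟨n₂, hev⟩ := ev_sqrt 1 (max c1 (c1 / Real.sqrt V))
  refine ⟨c1 + 1 / 2, by positivity, max n₁ (max n₂ 1), fun n hn M hM f φ hφ => ?_⟩
  have hn1 : n₁ ≤ n := le_trans (le_max_left _ _) hn
  have hn2 : n₂ ≤ n := le_trans (le_trans (le_max_left _ _) (le_max_right _ _)) hn
  have hn0 : 0 < n := le_trans (le_trans (le_max_right _ _) (le_max_right _ _)) hn
  have hnr : (0:ℝ) < n := by exact_mod_cast hn0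
  obtain ⟨hl1, hls, -⟩ := hev n hn2
  have hsn : 0 < Real.sqrt n := Real.sqrt_pos.2 hnr
  set l := Real.log n with hl
  have hl0 : 0 < l := by linarith
  have hls1 : c1 * l ≤ Real.sqrt n :=
    (mul_le_mul_of_nonneg_right (le_max_left _ _) hl0.le).trans hls
  have hls2 : c1 / Real.sqrt V * l ≤ Real.sqrt n :=
    (mul_le_mul_of_nonneg_right (le_max_right _ _) hl0.le).trans hls
  have hsq : Real.sqrt (n * V) = Real.sqrt n * Real.sqrt V := Real.sqrt_mul hnr.le _
  by_contra hcon
  push Not at hcon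
  set t := Real.sqrt (n * V) * z - c1 * l with ht
  have h1 := conv_bound hP0 hlam j hk hn0 hM f φ (1 / 2 * l)
  have hexp : Real.exp (-(1 / 2 * l)) = 1 / Real.sqrt n := by
    rw [Real.exp_neg, mul_comm, hl, Real.exp_mul, Real.exp_log hnr, ← Real.sqrt_eq_rpow, one_div]
  have hsub : {xs : Fin n → 𝒳 | t ≤ ∑ i, (j (xs i) - R)} ⊆
      {xs | 1 / 2 * l + Real.log M ≤ ∑ i, j (xs i)} := by
    intro xs hx
    have hx' : t ≤ ∑ i, (j (xs i) - R) := hx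
    rw [Finset.sum_sub_distrib] at hx'
    simp at hx'
    change 1 / 2 * l + Real.log M ≤ ∑ i, j (xs i)
    linarith
  have h2 := Pr_mono (iidP_nonneg hP0 n) hsub
  have h3 := hbe n hn1 t (by
    rw [ht, hsq]
    refine (abs_sub _ _).trans ?_
    rw [abs_mul, abs_of_pos (by positivity : 0 < Real.sqrt n * Real.sqrt V),
      abs_of_pos (by positivity : 0 < c1 * l)]
    nlinarith)
  have hh : t / Real.sqrt (n * V) = z - c1 / Real.sqrt V * (l / Real.sqrt n) := by
    rw [ht, hsq]; field_simp
  rw [hh] at h3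
  have h4 := (hsl (c1 / Real.sqrt V * (l / Real.sqrt n)) (by positivity) (by
    rw [← mul_div_assoc, div_le_one hsn]; exact hls2)).1
  have e : c * (c1 / Real.sqrt V * (l / Real.sqrt n)) = (Cb + 2) * (l / Real.sqrt n) := by
    rw [hc1]; field_simp
  rw [e, hz] at h4
  rw [hexp] at h1
  have h5 : 1 / Real.sqrt n ≤ l / Real.sqrt n := by gcongr
  have h6 : 0 < l / Real.sqrt n := by positivity
  linarith

set_option maxHeartbeats 1000000 in
lemma ach_asymp {𝒳 Xh : Type*} [Fintype 𝒳] [Fintype Xh]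
    {P : 𝒳 → ℝ} (hP0 : ∀ x, 0 ≤ P x) (hP1 : ∑ x, P x = 1) {d : 𝒳 → Xh → ℝ} {D lam : ℝ}
    (hlam : 0 ≤ lam) {B : ℝ} (hB : 0 < B) (hd : ∀ x y, 0 ≤ d x y) (hdB : ∀ x y, d x y ≤ B)
    {Q : Xh → ℝ} (hQ0 : ∀ y, 0 ≤ Q y) (hQ1 : ∑ y, Q y = 1)
    {R V z ε : ℝ} (hR : ∑ x, P x * dtilted d D Q lam x = R) (hRp : 0 < R)
    (hV : V = ∑ x, P x * (dtilted d D Q lam x - R) ^ 2) (hVp : 0 < V)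
    (hz : gaussQ z = ε) (hμ : ∑ x, P x * muf d Q lam x = D) (hv : 0 < ∑ x, P x * vf d Q lam x) :
    ∃ C > 0, ∃ n₀ : ℕ, ∀ n ≥ n₀, ∃ M : ℕ, 0 < M ∧ (∃ (f : (Fin n → 𝒳) → Fin M)
      (φ : Fin M → (Fin n → Xh)), Pr (iidP P n) {xs | D < distn d xs (φ (f xs))} ≤ ε) ∧
      Real.log M ≤ n * R + Real.sqrt (n * V) * z + C * Real.log n := by
  set j := dtilted d D Q lam with hj
  set vb := ∑ x, P x * vf d Q lam x with hvb
  have hcen : ∑ x, P x * (j x - R) = 0 := by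
    simp [mul_sub, Finset.sum_sub_distrib, hR, ← Finset.sum_mul, hP1]
  obtain ⟨c, hc, hsl⟩ := gaussQ_slope z
  have hsV : 0 < Real.sqrt V := Real.sqrt_pos.2 hVp
  obtain ⟨Cb, hCb, n₁, hbe⟩ := be_upper P hP0 hP1 (fun x => j x - R) hcen V hV hVp
    (Real.sqrt V * |z| + 1) (by positivity)
  obtain ⟨K1, hK1, m₁, hd1⟩ := mod_dev P hP0 hP1 (fun x => muf d Q lam x - D) (by
    simp [mul_sub, Finset.sum_sub_distrib, hμ, ← Finset.sum_mul, hP1])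
  obtain ⟨K2, hK2, m₂, hd2⟩ := mod_dev P hP0 hP1 (fun x => D - muf d Q lam x) (by
    simp [mul_sub, Finset.sum_sub_distrib, hμ, ← Finset.sum_mul, hP1])
  obtain ⟨K3, hK3, m₃, hd3⟩ := mod_dev P hP0 hP1 (fun x => vb - vf d Q lam x) (by
    simp only [mul_sub, Finset.sum_sub_distrib, ← Finset.sum_mul, hP1, ← hvb]; ring)
  obtain ⟨Ca, hCa, n₃, hball⟩ := ball_lb hQ0 hQ1 hlam hB hd hdB D (max K1 K2) (vb / 2)
    (lt_max_of_lt_left hK1) (by positivity)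
  set c1 := (Cb + 4) * Real.sqrt V / c with hc1
  have hc1p : 0 < c1 := by positivity
  obtain ⟨n₂, hev⟩ := ev_sqrt (max 1 (Real.sqrt V * |z| / R))
    (max (c1 / Real.sqrt V) (max c1 (2 * K3 / vb)))
  refine ⟨c1 + Ca + 2, by positivity, max n₁ (max n₂ (max m₁ (max m₂ (max m₃ (max n₃ 1))))),
    fun n hn => ?_⟩
  simp only [ge_iff_le, max_le_iff] at hn
  obtain ⟨hn1, hn2, hm1, hm2, hm3, hn3, hn0⟩ := hn
  have hnr : (0:ℝ) < n := by exact_mod_cast hn0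
  obtain ⟨hl1', hls, hs1⟩ := hev n hn2
  have hl1 := (le_max_left _ _).trans hl1'
  have hsz := (le_max_right _ _).trans hs1
  have hsn : 0 < Real.sqrt n := Real.sqrt_pos.2 hnr
  have hsn2 : Real.sqrt n * Real.sqrt n = n := Real.mul_self_sqrt hnr.le
  set l := Real.log n with hl
  have hl0 : 0 < l := by linarith
  have hls2 : c1 / Real.sqrt V * l ≤ Real.sqrt n :=
    (mul_le_mul_of_nonneg_right (le_max_left _ _) hl0.le).trans hls
  have hls1 : c1 * l ≤ Real.sqrt n :=
    (mul_le_mul_of_nonneg_right ((le_max_left _ _).trans (le_max_right _ _)) hl0.le).trans hls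
  have hls3 : 2 * K3 / vb * l ≤ Real.sqrt n :=
    (mul_le_mul_of_nonneg_right ((le_max_right _ _).trans (le_max_right _ _)) hl0.le).trans hls
  have hsq : Real.sqrt (n * V) = Real.sqrt n * Real.sqrt V := Real.sqrt_mul hnr.le _
  have hbase : 0 ≤ n * R + Real.sqrt (n * V) * z := by
    rw [div_le_iff₀ hRp] at hsz
    have h1 : -|z| ≤ z := neg_abs_le z
    have h2 : 0 ≤ Real.sqrt n * (Real.sqrt n * R - Real.sqrt V * |z|) :=
      mul_nonneg hsn.le (by linarith)
    have h3 : Real.sqrt n * Real.sqrt V * (-|z|) ≤ Real.sqrt n * Real.sqrt V * z := by gcongr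
    rw [hsq]
    nlinarith
  set t := Real.sqrt (n * V) * z + c1 * l with ht
  set τ := n * R + t with hτ
  set X := Real.exp (τ + Ca * l + l) with hX
  have hτ0 : 0 ≤ τ := by
    have : 0 ≤ c1 * l := by positivity
    linarith
  have hX1 : 1 ≤ X := Real.one_le_exp (by positivity)
  set M := ⌈X⌉₊ with hM
  have hM0 : 0 < M := Nat.ceil_pos.2 (by linarith)
  have hMX : X ≤ M := Nat.le_ceil X
  have hM2 : (M:ℝ) ≤ 2 * X := by
    have := Nat.ceil_lt_add_one (show 0 ≤ X by linarith)
    rw [← hM] at this; linarith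
  set G : Set (Fin n → 𝒳) := {xs | |∑ i, (muf d Q lam (xs i) - D)| ≤
    max K1 K2 * Real.sqrt (n * l) ∧ vb / 2 * n ≤ ∑ i, vf d Q lam (xs i) ∧ ∑ i, j (xs i) ≤ τ} with hG
  have h0 := iidP_nonneg hP0 n
  obtain ⟨f, φ, hcov⟩ := cover h0 (iidP_sum_one hP1 n) (iidP_nonneg hQ0 n)
    (iidP_sum_one hQ1 n) (fun xs ys => distn d xs ys ≤ D) G (Real.exp (-(τ + Ca * l)))
    (fun xs hx => by
      obtain ⟨ha, hb, hc⟩ := hx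
      refine le_trans (Real.exp_le_exp.2 ?_) (hball n hn3 xs ha hb)
      linarith) hM0
  refine ⟨M, hM0, ⟨f, φ, ?_⟩, ?_⟩
  · -- probability bound
    have hpM : Real.exp (-(Real.exp (-(τ + Ca * l)) * M)) ≤ 1 / n := by
      have h1 : l ≤ Real.exp (-(τ + Ca * l)) * M := by
        calc l ≤ n := by rw [hl]; exact Real.log_le_self hnr.le
          _ = Real.exp (-(τ + Ca * l)) * X := by
              rw [hX, ← Real.exp_add]
              have : -(τ + Ca * l) + (τ + Ca * l + l) = l := by ring
              rw [this, hl, Real.exp_log hnr]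
          _ ≤ _ := by gcongr
      calc _ ≤ Real.exp (-l) := Real.exp_le_exp.2 (by linarith)
        _ = 1 / n := by rw [Real.exp_neg, hl, Real.exp_log hnr, one_div]
    have hsub : {xs | D < distn d xs (φ (f xs))} ⊆
        ({xs : Fin n → 𝒳 | K1 * Real.sqrt (n * l) < ∑ i, (muf d Q lam (xs i) - D)} ∪
         {xs | K2 * Real.sqrt (n * l) < ∑ i, (D - muf d Q lam (xs i))}) ∪
        ({xs | K3 * Real.sqrt (n * l) < ∑ i, (vb - vf d Q lam (xs i))} ∪
         {xs | t < ∑ i, (j (xs i) - R)}) ∪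
        {xs | xs ∈ G ∧ ¬ distn d xs (φ (f xs)) ≤ D} := by
      intro xs hx
      by_contra hcon
      simp only [Set.mem_union, not_or, Set.mem_ofPred_eq] at hcon
      obtain ⟨⟨⟨ha, hb⟩, hc, he⟩, hg⟩ := hcon
      have ha' := not_lt.1 ha
      have hb' := not_lt.1 hb
      have hc' := not_lt.1 hc
      have he' := not_lt.1 he
      apply hg
      refine ⟨⟨?_, ?_, ?_⟩, not_le.2 hx⟩
      · have hs := Real.sqrt_nonneg (n * l)
        have k1 := mul_le_mul_of_nonneg_right (le_max_left K1 K2) hs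
        have k2 := mul_le_mul_of_nonneg_right (le_max_right K1 K2) hs
        have e : ∑ i, (D - muf d Q lam (xs i)) = - ∑ i, (muf d Q lam (xs i) - D) := by
          rw [← Finset.sum_neg_distrib]; exact Finset.sum_congr rfl fun i _ => by ring
        rw [abs_le]
        constructor <;> linarith
      · have e : ∑ i, (vb - vf d Q lam (xs i)) = n * vb - ∑ i, vf d Q lam (xs i) := by
          rw [Finset.sum_sub_distrib]; simp
        have h1 : Real.sqrt (n * l) ≤ Real.sqrt n * l := by
          rw [Real.sqrt_mul hnr.le]
          refine mul_le_mul_of_nonneg_left ?_ hsn.le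
          rw [Real.sqrt_le_left hl0.le]; nlinarith
        have h2 : K3 * l ≤ vb / 2 * Real.sqrt n := by
          rw [div_mul_eq_mul_div, div_le_iff₀ hv] at hls3; linarith
        have h3 : K3 * Real.sqrt (n * l) ≤ vb / 2 * n := by
          calc _ ≤ K3 * (Real.sqrt n * l) := by gcongr
            _ = (K3 * l) * Real.sqrt n := by ring
            _ ≤ vb / 2 * Real.sqrt n * Real.sqrt n := by gcongr
            _ = vb / 2 * n := by rw [mul_assoc, hsn2]
        linarith
      · rw [Finset.sum_sub_distrib] at he'
        simp at he'
        linarith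
    have hbe' := hbe n hn1 t (by
      rw [ht, hsq]
      refine (abs_add_le _ _).trans ?_
      rw [abs_mul, abs_of_pos (by positivity : 0 < Real.sqrt n * Real.sqrt V),
        abs_of_pos (by positivity : 0 < c1 * l)]
      nlinarith)
    have hh : t / Real.sqrt (n * V) = z + c1 / Real.sqrt V * (l / Real.sqrt n) := by
      rw [ht, hsq]; field_simp
    rw [hh] at hbe'
    have h4 := (hsl (c1 / Real.sqrt V * (l / Real.sqrt n)) (by positivity) (by
      rw [← mul_div_assoc, div_le_one hsn]; exact hls2)).2
    have e : c * (c1 / Real.sqrt V * (l / Real.sqrt n)) = (Cb + 4) * (l / Real.sqrt n) := by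
      rw [hc1]; field_simp
    rw [e, hz] at h4
    have hinv : 1 / (n:ℝ) ≤ l / Real.sqrt n := by
      have h1 : 1 ≤ Real.sqrt n := by
        rw [Real.one_le_sqrt]; exact_mod_cast hn0
      have h2 : Real.sqrt n ≤ n := by
        calc Real.sqrt n = Real.sqrt n * 1 := (mul_one _).symm
          _ ≤ Real.sqrt n * Real.sqrt n := by gcongr
          _ = n := hsn2
      exact (one_div_le_one_div_of_le hsn h2).trans (by gcongr)
    have p1 := hd1 n hm1
    have p2 := hd2 n hm2
    have p3 := hd3 n hm3
    refine (Pr_mono h0 hsub).trans ?_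
    refine (Pr_union_le h0 _ _).trans ?_
    have q1 := Pr_union_le h0 ({xs : Fin n → 𝒳 | K1 * Real.sqrt (n * l) < ∑ i, (muf d Q lam (xs i) - D)} ∪
         {xs | K2 * Real.sqrt (n * l) < ∑ i, (D - muf d Q lam (xs i))})
        ({xs | K3 * Real.sqrt (n * l) < ∑ i, (vb - vf d Q lam (xs i))} ∪
         {xs | t < ∑ i, (j (xs i) - R)})
    have q2 := Pr_union_le h0 {xs : Fin n → 𝒳 | K1 * Real.sqrt (n * l) < ∑ i, (muf d Q lam (xs i) - D)}
         {xs | K2 * Real.sqrt (n * l) < ∑ i, (D - muf d Q lam (xs i))}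
    have q3 := Pr_union_le h0 {xs : Fin n → 𝒳 | K3 * Real.sqrt (n * l) < ∑ i, (vb - vf d Q lam (xs i))}
         {xs | t < ∑ i, (j (xs i) - R)}
    linarith
  · have : Real.log M ≤ Real.log (2 * X) := Real.log_le_log (by exact_mod_cast hM0) hM2
    rw [Real.log_mul two_ne_zero (by linarith), hX, Real.log_exp] at this
    have h2 : Real.log 2 ≤ 1 := by linarith [Real.log_le_sub_one_of_pos (show (0:ℝ) < 2 by norm_num)]
    linarith

/-- **Second-order asymptotics for the rate-distortion problem.**  For a DMS `P`,
a distortion level `D ∈ (D_min, D_max)` and every `ε ∈ (0,1)`,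
`log M*(n,D,ε) = n R(P,D) + √(n V(P,D)) Q⁻¹(ε) + O(log n)`,
where `V(P,D)` is the variance of the `D`-tilted information density and `Q(z) = ε`. -/
theorem rd_second_order
    {𝒳 Xh : Type} [Fintype 𝒳] [Fintype Xh] [Nonempty Xh]
    (P : 𝒳 → ℝ) (hP0 : ∀ x, 0 ≤ P x) (hP1 : ∑ x, P x = 1)
    (d : 𝒳 → Xh → ℝ) (hd : ∀ x y, 0 ≤ d x y) (D : ℝ)
    (hDmin : (∑ x, P x * ⨅ y, d x y) < D)
    (hDmax : D < ⨅ y, ∑ x, P x * d x y)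
    (hreg : ContDiffAt ℝ 2 (fun q : (𝒳 → ℝ) × ℝ => RDfun q.1 d q.2) (P, D))
    (Wopt : 𝒳 → Xh → ℝ) (hWch : IsChannel Wopt)
    (hWd : (∑ x, ∑ y, P x * Wopt x y * d x y) ≤ D)
    (hWopt : mutInfo P Wopt = RDfun P d D)
    (lam : ℝ) (hlam : HasDerivAt (fun D' => RDfun P d D') (-lam) D) (hlam0 : 0 ≤ lam)
    (hV : 0 < varF P (dtilted d D (outMarg P Wopt) lam))
    (ε : ℝ) (hε : ε ∈ Set.Ioo (0 : ℝ) 1) (z : ℝ) (hz : gaussQ z = ε) :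
    ∃ C > (0 : ℝ), ∃ n₀ : ℕ, ∀ n ≥ n₀,
      |Real.log (MstarRD P d n D ε)
          - (n * RDfun P d D
              + Real.sqrt (n * varF P (dtilted d D (outMarg P Wopt) lam)) * z)| ≤
        C * Real.log n := by
  classical
  set Q := outMarg P Wopt with hQ
  have hQ0 : ∀ y, 0 ≤ Q y := outMarg_nonneg hP0 hWch
  have hQ1 : ∑ y, Q y = 1 := outMarg_sum hP1 hWch
  have hlp : 0 < lam := by
    refine lt_of_le_of_ne hlam0 fun h => ?_
    have hj : ∀ x, dtilted d D Q lam x = 0 := by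
      intro x; simp [dtilted, ← h, hQ1]
    have : varF P (dtilted d D Q lam) = 0 := by simp [varF, meanF, hj]
    linarith
  have hRp : 0 < RDfun P d D := by
    have hnn : ∀ D', 0 ≤ RDfun P d D' := by
      intro D'
      refine Real.sInf_nonneg ?_
      rintro r ⟨W', hW', -, rfl⟩
      exact mutInfo_nonneg hP0 hP1 hW'
    refine lt_of_le_of_ne (hnn D) fun h => ?_
    have hmin : IsLocalMin (fun D' => RDfun P d D') D :=
      Filter.Eventually.of_forall fun D' => by beta_reduce; rw [← h]; exact hnn D'
    have := hmin.hasDerivAt_eq_zero hlam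
    linarith
  obtain ⟨k1, k2, k3, k4⟩ := kkt hP0 hP1 hWch hWd hWopt hlam hlp hQ
  have hR : ∑ x, P x * dtilted d D Q lam x = RDfun P d D := by
    simp only [dtilted_eq hQ0 hQ1, mul_sub, Finset.sum_sub_distrib, ← Finset.sum_mul, hP1]
    linarith
  have hVeq : varF P (dtilted d D Q lam) = ∑ x, P x * (dtilted d D Q lam x - RDfun P d D) ^ 2 := by
    unfold varF meanF; rw [hR]
  have hk : ∀ y, ∑ x, P x * Real.exp (dtilted d D Q lam x + lam * D - lam * d x y) ≤ 1 := by
    intro y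
    refine le_trans (le_of_eq ?_) (k4 y)
    refine Finset.sum_congr rfl fun x _ => ?_
    rw [dtilted_eq hQ0 hQ1]
    have e : -(lam * D) - Real.log (Zf d Q lam x) + lam * D - lam * d x y =
      -(lam * d x y) - Real.log (Zf d Q lam x) := by ring
    rw [e, Real.exp_sub, Real.exp_log (Zf_pos hQ0 hQ1 lam x)]
  have hμ : ∑ x, P x * muf d Q lam x = D := by
    rw [← k3]
    refine Finset.sum_congr rfl fun x _ => ?_
    rcases (hP0 x).eq_or_lt with hx | hx
    · simp [← hx]
    · unfold muf
      rw [Finset.mul_sum]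
      refine Finset.sum_congr rfl fun y _ => ?_
      rw [k2 x hx y, Wst]; ring
  have hW0 := Wst_nonneg (d := d) hQ0 hQ1 lam
  have hvn : ∀ x, 0 ≤ vf d Q lam x := fun x =>
    Finset.sum_nonneg fun y _ => mul_nonneg (hW0 x y) (sq_nonneg _)
  have hv : 0 < ∑ x, P x * vf d Q lam x := by
    refine lt_of_le_of_ne (Finset.sum_nonneg fun x _ => mul_nonneg (hP0 x) (hvn x)) fun h => ?_
    have h1 := (Finset.sum_eq_zero_iff_of_nonneg
      (fun x _ => mul_nonneg (hP0 x) (hvn x))).1 h.symm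
    obtain ⟨y, hy⟩ : ∃ y, 0 < Q y := by
      by_contra hcon
      push Not at hcon
      have : ∑ y, Q y ≤ 0 := Finset.sum_nonpos fun y _ => hcon y
      linarith
    have h2 : ∑ x, P x * d x y = D := by
      rw [← hμ]
      refine Finset.sum_congr rfl fun x _ => ?_
      rcases mul_eq_zero.1 (h1 x (Finset.mem_univ _)) with h | h
      · simp [h]
      · have h3 := (Finset.sum_eq_zero_iff_of_nonneg
          (fun y _ => mul_nonneg (hW0 x y) (sq_nonneg _))).1 h y (Finset.mem_univ _)
        have hw : 0 < Wst d Q lam x y :=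
          div_pos (mul_pos hy (Real.exp_pos _)) (Zf_pos hQ0 hQ1 lam x)
        rcases mul_eq_zero.1 h3 with h | h
        · exact absurd h hw.ne'
        · rw [sub_eq_zero.1 (pow_eq_zero_iff two_ne_zero |>.1 h)]
    have h3 : (⨅ y, ∑ x, P x * d x y) ≤ ∑ x, P x * d x y :=
      ciInf_le (Set.finite_range _).bddBelow y
    linarith
  have hsum0 : 0 ≤ ∑ x, ∑ y, d x y :=
    Finset.sum_nonneg fun x _ => Finset.sum_nonneg fun y _ => hd x y
  have hdB : ∀ x y, d x y ≤ 1 + ∑ x, ∑ y, d x y := by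
    intro x y
    have h1 : d x y ≤ ∑ y, d x y :=
      Finset.single_le_sum (f := fun y => d x y) (fun y _ => hd x y) (Finset.mem_univ y)
    have h2 : ∑ y, d x y ≤ ∑ x, ∑ y, d x y :=
      Finset.single_le_sum (f := fun x => ∑ y, d x y)
        (fun x _ => Finset.sum_nonneg fun y _ => hd x y) (Finset.mem_univ x)
    linarith
  obtain ⟨C1, hC1, n₁, hconv⟩ := conv_asymp hP0 hP1 hlam0 _ hk hR hVeq hV hz
  obtain ⟨C2, hC2, n₂, hach⟩ := ach_asymp hP0 hP1 hlam0 (by linarith) hd hdB hQ0 hQ1 hR hRp hVeq hV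
    hz hμ hv
  refine ⟨max C1 C2, lt_max_of_lt_left hC1, max n₁ (max n₂ 1), fun n hn => ?_⟩
  simp only [ge_iff_le, max_le_iff] at hn
  obtain ⟨hn1, hn2, hn0⟩ := hn
  have hl0 : 0 ≤ Real.log n := Real.log_natCast_nonneg n
  obtain ⟨M, hM0, ⟨f, φ, hfφ⟩, hlog⟩ := hach n hn2
  have hmem : MstarRD P d n D ε ∈ {M : ℕ | 0 < M ∧ ∃ (f : (Fin n → 𝒳) → Fin M)
      (φ : Fin M → (Fin n → Xh)), Pr (iidP P n) {xs | D < distn d xs (φ (f xs))} ≤ ε} :=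
    Nat.sInf_mem ⟨M, hM0, f, φ, hfφ⟩
  have hle : MstarRD P d n D ε ≤ M := Nat.sInf_le ⟨hM0, f, φ, hfφ⟩
  obtain ⟨hs0, f', φ', hs⟩ := hmem
  have hlow := hconv n hn1 _ hs0 f' φ' hs
  have hup : Real.log (MstarRD P d n D ε) ≤ Real.log M :=
    Real.log_le_log (by exact_mod_cast hs0) (by exact_mod_cast hle)
  have m1 := mul_le_mul_of_nonneg_right (le_max_left C1 C2) hl0
  have m2 := mul_le_mul_of_nonneg_right (le_max_right C1 C2) hl0
  rw [abs_le]
  constructor <;> linarith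

end
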